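/- arXiv:2302.01808 — 5 statements merged into one kernel-verified Lean document; each statement's English description precedes it below -/
import Mathlib

section
/- Let S⃗ be a finite submodular separation system inside a universe of separations, and let F be a standard set of stars in S⃗ that is closed under shifting and contains {r*} for every small r ∈ S⃗. Let σ = {s_1, …, s_n} ⊆ S⃗ be a non-empty star that is inessential for the set of all F-tangles of S, and suppose that for each i ∈ {1, …, n} the inverse s_i* is closely related to some F-tangle of S. Then there is an S-tree over F ∪ {{s_1*}, …, {s_n*}} in which each s_i appears as a leaf separation. -/
namespace SepSys

variable {U : Type*} [Lattice U]

/-- `inv` is an order-reversing involution on the universe `U`. -/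
def IsInvol (inv : U → U) : Prop :=
  (∀ s, inv (inv s) = s) ∧ ∀ r s : U, r ≤ s → inv s ≤ inv r

/-- `Sv` is a separation system inside the universe `U`: a subset closed under the involution. -/
def IsSepSys (inv : U → U) (Sv : Set U) : Prop :=
  ∀ s ∈ Sv, inv s ∈ Sv

/-- structural submodularity of a separation system inside a universe -/
def SubmodularSys (Sv : Set U) : Prop :=
  ∀ r ∈ Sv, ∀ s ∈ Sv, r ⊔ s ∈ Sv ∨ r ⊓ s ∈ Sv

/-- the (unoriented) separations underlying `r` and `s` are nested -/
def Nested (inv : U → U) (r s : U) : Prop :=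
  r ≤ s ∨ r ≤ inv s ∨ inv r ≤ s ∨ inv r ≤ inv s

def NestedSet (inv : U → U) (N : Set U) : Prop :=
  ∀ r ∈ N, ∀ s ∈ N, Nested inv r s

def NestedWithAll (inv : U → U) (M : Set U) (s : U) : Prop :=
  ∀ m ∈ M, Nested inv s m

/-- `N` represents a set of unoriented separations of `Sv`:
we represent such a set by the set of all orientations of its elements. -/
def UnorientedIn (inv : U → U) (Sv N : Set U) : Prop :=
  N ⊆ Sv ∧ ∀ s ∈ N, inv s ∈ N

/-- `O` is an orientation of (the set of unoriented separations of) `Sv` -/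
def IsOrientation (inv : U → U) (Sv O : Set U) : Prop :=
  O ⊆ Sv ∧ (∀ s ∈ Sv, s ∈ O ∨ inv s ∈ O) ∧ ∀ s ∈ O, inv s ∈ O → inv s = s

def Consistent (inv : U → U) (O : Set U) : Prop :=
  ∀ a ∈ O, ∀ b ∈ O, a ≠ b → ¬ inv a < b

def IsProfile (inv : U → U) (Sv P : Set U) : Prop :=
  IsOrientation inv Sv P ∧ Consistent inv P ∧ ∀ r ∈ P, ∀ s ∈ P, inv (r ⊔ s) ∉ P

def IsStarIn (inv : U → U) (Sv σ : Set U) : Prop :=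
  σ ⊆ Sv ∧ (∀ s ∈ σ, inv s ≠ s) ∧ ∀ r ∈ σ, ∀ s ∈ σ, r ≠ s → r ≤ inv s

def IsFTangle (inv : U → U) (Sv : Set U) (F : Set (Set U)) (O : Set U) : Prop :=
  IsOrientation inv Sv O ∧ Consistent inv O ∧ ∀ σ ∈ F, ¬ σ ⊆ O

/-- the non-degenerate separation underlying `s` distinguishes `O` and `O'` -/
def Distinguishes (inv : U → U) (s : U) (O O' : Set U) : Prop :=
  inv s ≠ s ∧ ((s ∈ O ∧ inv s ∈ O') ∨ (inv s ∈ O ∧ s ∈ O'))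

def DistinguishesAll (inv : U → U) (N : Set U) (Ps : Set (Set U)) : Prop :=
  ∀ P ∈ Ps, ∀ P' ∈ Ps, P ≠ P' → ∃ s ∈ N, Distinguishes inv s P P'

def CloselyRelated (inv : U → U) (Sv O : Set U) (s : U) : Prop :=
  s ∈ O ∧ ∀ r ∈ O, s ⊓ r ∈ Sv

def DistinguishesWell (inv : U → U) (Sv P P' : Set U) (s : U) : Prop :=
  (CloselyRelated inv Sv P s ∧ CloselyRelated inv Sv P' (inv s)) ∨
    (CloselyRelated inv Sv P' s ∧ CloselyRelated inv Sv P (inv s))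

def GoodFor (inv : U → U) (Sv : Set U) (Ps : Set (Set U)) (s : U) : Prop :=
  ∃ P ∈ Ps, ∃ P' ∈ Ps, P ≠ P' ∧ DistinguishesWell inv Sv P P' s

def MaxElems (O : Set U) : Set U :=
  {x ∈ O | ∀ y ∈ O, x ≤ y → x = y}

/-- `σ` is a node of the nested set `N` (represented with all orientations of its elements) -/
def IsNode (inv : U → U) (N σ : Set U) : Prop :=
  IsStarIn inv N σ ∧ ∃ O, IsOrientation inv N O ∧ Consistent inv O ∧ σ = MaxElems O

def IsTrivialIn (inv : U → U) (Sv : Set U) (s : U) : Prop :=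
  ∃ r ∈ Sv, ({r, inv r} : Set U) ≠ {s, inv s} ∧ s < r ∧ s < inv r

def SmallSep (inv : U → U) (s : U) : Prop := s ≤ inv s

def StandardSet (inv : U → U) (Sv : Set U) (F : Set (Set U)) : Prop :=
  ∀ s ∈ Sv, IsTrivialIn inv Sv s → ({inv s} : Set U) ∈ F

def Emulates (inv : U → U) (Sv : Set U) (r s : U) : Prop :=
  r ≤ s ∧ ∀ x ∈ Sv, r ≤ x → x ≠ inv r → s ⊔ x ∈ Sv

open Classical in
/-- the shifting map `f↓` -/
noncomputable def shiftMap (inv : U → U) (r s x : U) : U :=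
  if r ≤ x then x ⊔ s else inv (inv x ⊔ s)

def ClosedUnderShifting (inv : U → U) (Sv : Set U) (F : Set (Set U)) : Prop :=
  ∀ r ∈ Sv, ∀ s ∈ Sv, inv r ≠ r → ¬ IsTrivialIn inv Sv r → Emulates inv Sv r s →
    ∀ σ ∈ F, (∀ x ∈ σ, x ∈ Sv ∧ (r ≤ x ∨ r ≤ inv x) ∧ x ≠ inv r) →
      (∃ t ∈ σ, r ≤ t) → shiftMap inv r s '' σ ∈ F

def Friendly (inv : U → U) (Sv : Set U) (F : Set (Set U)) : Prop :=
  (∀ σ ∈ F, IsStarIn inv Sv σ) ∧ StandardSet inv Sv F ∧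
    ClosedUnderShifting inv Sv F ∧
    (∀ s ∈ Sv, SmallSep inv s → ({inv s} : Set U) ∈ F) ∧
    ∀ O, IsFTangle inv Sv F O → IsProfile inv Sv O

def IsAut (inv : U → U) (Sv : Set U) (φ : U → U) : Prop :=
  Set.BijOn φ Sv Sv ∧ (∀ r ∈ Sv, ∀ s ∈ Sv, (r ≤ s ↔ φ r ≤ φ s)) ∧
    ∀ s ∈ Sv, φ (inv s) = inv (φ s)

/-- the separations of `Sv` that are nested with all separations in `M` -/
def SvM (inv : U → U) (Sv M : Set U) : Set U :=
  {s ∈ Sv | NestedWithAll inv M s}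

/-- the set `E_P` of `P`-exclusive separations in `P_M` distinguishing `P` well
from some other profile in `Ps` -/
def EP (inv : U → U) (Sv M : Set U) (Ps : Set (Set U)) (P : Set U) : Set U :=
  {s ∈ P ∩ SvM inv Sv M | (∀ P' ∈ Ps, s ∈ P' → P' = P) ∧
    ∃ P' ∈ Ps, P' ≠ P ∧ DistinguishesWell inv Sv P P' s}

/-- the set `M_{P,i}` from the construction of the canonical nested set:
separations nested with the previously chosen set `N` that are `P`-exclusive
for the remaining profiles `Q` and maximal in `P ∩ S⃗_i` -/
def MpOf (inv : U → U) (Sv N : Set U) (Q : Set (Set U)) (P : Set U) : Set U :=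
  {s ∈ SvM inv Sv N | s ∈ P ∧ (∀ P' ∈ Q, s ∈ P' → P' = P) ∧
    ∀ x ∈ P ∩ SvM inv Sv N, s ≤ x → s = x}

def QiOf (inv : U → U) (Sv N : Set U) (Q : Set (Set U)) : Set (Set U) :=
  {P ∈ Q | (MpOf inv Sv N Q P).Nonempty}

/-- step `i` of the construction: the pair `(N_i, Ps_{≥ i+1})` -/
def constrStep (inv : U → U) (Sv : Set U) (Ps : Set (Set U)) : ℕ → Set U × Set (Set U)
  | 0 => (∅, Ps)
  | (i+1) =>
      let p := constrStep inv Sv Ps i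
      (p.1 ∪ {x | ∃ P ∈ QiOf inv Sv p.1 p.2, ∃ y,
          IsGLB (MpOf inv Sv p.1 p.2 P) y ∧ (x = y ∨ x = inv y)},
        p.2 \ QiOf inv Sv p.1 p.2)

/-- the least `K` such that `Ps_{≥ K+1}` contains at most one profile -/
noncomputable def stopIndex (inv : U → U) (Sv : Set U) (Ps : Set (Set U)) : ℕ :=
  sInf {i | ((constrStep inv Sv Ps i).2).Subsingleton}

/-- the canonical nested set `N(S⃗, Ps)` -/
noncomputable def canonicalN (inv : U → U) (Sv : Set U) (Ps : Set (Set U)) : Set U :=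
  (constrStep inv Sv Ps (stopIndex inv Sv Ps)).1

end SepSys

namespace SepSys

section Order

variable {U : Type*} [Lattice U] {inv : U → U} {Sv : Set U} {F : Set (Set U)}

theorem IsInvol.inv_le_comm (hinv : IsInvol inv) {x y : U} : inv x ≤ y ↔ inv y ≤ x := by
  constructor <;> intro h
  · simpa [hinv.1] using hinv.2 _ _ h
  · simpa [hinv.1] using hinv.2 _ _ h

theorem IsInvol.le_inv_comm (hinv : IsInvol inv) {x y : U} : x ≤ inv y ↔ y ≤ inv x := by
  constructor <;> intro h
  · simpa [hinv.1] using hinv.2 _ _ h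
  · simpa [hinv.1] using hinv.2 _ _ h

theorem IsInvol.inv_inf (hinv : IsInvol inv) (x y : U) : inv (x ⊓ y) = inv x ⊔ inv y := by
  apply le_antisymm
  · rw [hinv.inv_le_comm]
    exact le_inf (hinv.inv_le_comm.1 le_sup_left) (hinv.inv_le_comm.1 le_sup_right)
  · exact sup_le (hinv.2 _ _ inf_le_left) (hinv.2 _ _ inf_le_right)

/-- If the inverses of small separations form singletons in `F`, then an `F`-tangle contains no two
elements pointing away from each other. -/
theorem IsFTangle.not_inv_le (hinv : IsInvol inv) (hsys : IsSepSys inv Sv)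
    (hFsmall : ∀ s ∈ Sv, SmallSep inv s → ({inv s} : Set U) ∈ F) {O : Set U} (hO : IsFTangle inv Sv F O) {a b : U} (ha : a ∈ O) (hb : b ∈ O) :
    ¬ inv a ≤ b := by
  intro hab
  obtain ⟨⟨hOS, -, hOas⟩, hcons, hF⟩ := hO
  have key : ∀ c ∈ O, ¬ inv c ≤ c := by
    intro c hc hcc
    have := hFsmall (inv c) (hsys c (hOS hc)) (by simpa [SmallSep, hinv.1] using hcc)
    rw [hinv.1] at this
    exact hF _ this (by simpa using hc)
  by_cases h : a = b
  · subst h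
    exact key a ha hab
  · rcases hab.eq_or_lt with h' | h'
    · have := hOas a ha (h' ▸ hb)
      exact key a ha this.le
    · exact hcons a ha b hb h h'

theorem IsFTangle.mem_or_inv_mem {O : Set U} (hO : IsFTangle inv Sv F O) {a : U} (ha : a ∈ Sv) :
    a ∈ O ∨ inv a ∈ O := hO.1.2.1 a ha

/-- In a submodular separation system, between `r ≤ r'` there is an `s` whose join with everything
above `r` and whose meet with everything below `r'` stay in the system. -/
theorem SubmodularSys.exists_between (hfin : Sv.Finite) (hsub : SubmodularSys Sv) {r r' : U}
    (hr : r ∈ Sv) (hle : r ≤ r') :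
    ∃ s ∈ Sv, r ≤ s ∧ s ≤ r' ∧ (∀ x ∈ Sv, r ≤ x → s ⊔ x ∈ Sv) ∧ ∀ y ∈ Sv, y ≤ r' → s ⊓ y ∈ Sv := by
  obtain ⟨s, -, ⟨hsS, hrs, hsr', hsx⟩, hmax⟩ := Set.Finite.exists_le_maximal
    (s := {s ∈ Sv | r ≤ s ∧ s ≤ r' ∧ ∀ x ∈ Sv, r ≤ x → s ⊔ x ∈ Sv}) (hfin.subset fun _ h => h.1)
    (a := r) ⟨hr, le_rfl, hle, fun x hx hrx => by rwa [sup_eq_right.2 hrx]⟩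
  refine ⟨s, hsS, hrs, hsr', hsx, ?_⟩
  by_contra! hcon
  obtain ⟨y₀, hy₀S, hy₀r', hy₀⟩ := hcon
  obtain ⟨y, -, ⟨hyS, hyr', hy⟩, hmin⟩ := Set.Finite.exists_le_minimal
    (s := {y ∈ Sv | y ≤ r' ∧ s ⊓ y ∉ Sv}) (hfin.subset fun _ h => h.1)
    (a := y₀) ⟨hy₀S, hy₀r', hy₀⟩
  have hsy : s ⊔ y ∈ Sv := (hsub s hsS y hyS).resolve_right hy
  have hle' := hmax (y := s ⊔ y)
    ⟨hsy, hrs.trans le_sup_left, sup_le hsr' hyr', fun x hx hrx => ?_⟩ le_sup_left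
  · have : y ≤ s := le_sup_right.trans hle'
    rw [inf_eq_right.2 this] at hy
    exact hy hyS
  · have hx' := hsx x hx hrx
    have heq : s ⊔ y ⊔ x = (s ⊔ x) ⊔ y := by ac_rfl
    rw [heq]
    rcases hsub _ hx' y hyS with h | h
    · exact h
    · by_cases hyle : y ≤ s ⊔ x
      · rwa [sup_eq_left.2 hyle]
      · exfalso
        have hnot : s ⊓ ((s ⊔ x) ⊓ y) ∉ Sv := by
          rwa [← inf_assoc, inf_eq_left.2 (le_sup_left : s ≤ s ⊔ x)]
        exact hyle ((hmin ⟨h, inf_le_right.trans hyr', hnot⟩ inf_le_right).trans inf_le_left)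

/-- `Drv inv F A x` says that `x` is the separation pointing into a branch of an `S`-tree all of
whose stars are in `F` or of the form `{a}` with `a ∈ A`. -/
inductive Drv (inv : U → U) (F : Set (Set U)) (A : Set U) : U → Prop
  | leaf (x : U) : x ∈ A → Drv inv F A x
  | node (τ : Set U) (x : U) : τ ∈ F → x ∈ τ → (∀ y ∈ τ, y ≠ x → Drv inv F A (inv y)) →
      Drv inv F A x

theorem Drv.of_singleton {U : Type*} {inv : U → U} {F : Set (Set U)} {A : Set U} {x : U}
    (h : ({x} : Set U) ∈ F) : Drv inv F A x :=
  .node {x} x h rfl fun _ hy hne => absurd hy hne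

theorem Drv.mem (hFstar : ∀ σ ∈ F, IsStarIn inv Sv σ) {A : Set U} (hA : A ⊆ Sv) {x : U}
    (h : Drv inv F A x) : x ∈ Sv := by
  cases h with
  | leaf _ h => exact hA h
  | node τ _ hτ hx _ => exact (hFstar τ hτ).1 hx

theorem Drv.shift (hinv : IsInvol inv) (hsys : IsSepSys inv Sv)
    (hFstar : ∀ σ ∈ F, IsStarIn inv Sv σ) (hFshift : ClosedUnderShifting inv Sv F)
    (hFsmall : ∀ s ∈ Sv, SmallSep inv s → ({inv s} : Set U) ∈ F)
    {r s : U} (hr : r ∈ Sv) (hs : s ∈ Sv) (htriv : ¬ IsTrivialIn inv Sv r) (hrs : r ≤ s)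
    (hem : ∀ x ∈ Sv, r ≤ x → s ⊔ x ∈ Sv) {A A' : Set U}
    (hA : ∀ z ∈ A, r ≤ z → Drv inv F A' (z ⊔ s)) {z : U} (hz : Drv inv F A z) (hrz : r ≤ z) :
    Drv inv F A' (z ⊔ s) ∨ Drv inv F A' s := by
  induction hz with
  | leaf z hz => exact .inl (hA z hz hrz)
  | node τ z hτ hzτ hch ih =>
    by_cases hs' : Drv inv F A' s
    · exact .inr hs'
    left
    obtain ⟨hτS, hτnd, hτstar⟩ := hFstar τ hτ
    have hzS := hτS hzτ
    have hrinv : ∀ y ∈ τ, y ≠ z → r ≤ inv y := fun y hy hyz =>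
      hrz.trans (hτstar z hzτ y hy (Ne.symm hyz))
    have hch' : ∀ y ∈ τ, y ≠ z → Drv inv F A' (inv y ⊔ s) := fun y hy hyz =>
      (ih y hy hyz (hrinv y hy hyz)).resolve_right hs'
    by_cases hzr : z = inv r
    · subst hzr
      have hmem : inv r ⊔ s ∈ Sv := by
        rw [sup_comm]; exact hem _ hzS hrz
      have := hFsmall (inv (inv r ⊔ s)) (hsys _ hmem) (by
        rw [SmallSep, hinv.1]
        exact ((hinv.2 _ _ (le_sup_left)).trans (hinv.1 r).le).trans (hrs.trans le_sup_right))
      rw [hinv.1] at this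
      exact .of_singleton this
    have hnr : ∀ y ∈ τ, y ≠ inv r := by
      rintro y hy rfl
      have := hch' _ hy (Ne.symm hzr)
      rw [hinv.1, sup_eq_right.2 hrs] at this
      exact hs' this
    have hny : ∀ y ∈ τ, y ≠ z → ¬ r ≤ y := by
      intro y hy hyz hry
      have hry' := hrinv y hy hyz
      by_cases h1 : r = y
      · subst h1
        apply htriv
        have hrz' : r ≤ inv z := hτstar r hy z hzτ hyz
        have h2 : r ≠ inv z := fun h => hzr (by rw [h, hinv.1])
        refine ⟨z, hzS, fun hEq => ?_, lt_of_le_of_ne hrz (hyz), lt_of_le_of_ne hrz' h2⟩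
        have : z ∈ ({r, inv r} : Set U) := hEq ▸ (by simp)
        rcases this with h | h
        · exact hyz h.symm
        · exact hzr h
      · have h2 : r ≠ inv y := fun h => hnr y hy (by rw [h, hinv.1])
        refine htriv ⟨y, hτS hy, fun hEq => ?_, lt_of_le_of_ne hry h1, lt_of_le_of_ne hry' h2⟩
        have : y ∈ ({r, inv r} : Set U) := hEq ▸ (by simp)
        rcases this with h | h
        · exact h1 h.symm
        · exact hnr y hy h
    have hnd : inv r ≠ r := fun h => by
      have := hFsmall r hr (by rw [SmallSep, h])
      exact (hFstar _ this).2.1 (inv r) rfl (by rw [h, h])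
    have hmem := hFshift r hr s hs hnd htriv ⟨hrs, fun x hx hrx _ => hem x hx hrx⟩ τ hτ
      (fun x hx => ⟨hτS hx, by
        by_cases hxz : x = z
        · exact .inl (hxz ▸ hrz)
        · exact .inr (hrinv x hx hxz), hnr x hx⟩) ⟨z, hzτ, hrz⟩
    refine .node _ _ hmem ⟨z, hzτ, by simp [shiftMap, hrz]⟩ ?_
    rintro _ ⟨y, hy, rfl⟩ hne
    have hyz : y ≠ z := by
      rintro rfl
      exact hne (by simp [shiftMap, hrz])
    simp only [shiftMap, if_neg (hny y hy hyz), hinv.1]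
    exact hch' y hy hyz

/-- Adding a leaf `r` all of whose strict successors are already derivable. -/
theorem Drv.of_insert (hinv : IsInvol inv) (hFstar : ∀ σ ∈ F, IsStarIn inv Sv σ)
    (hFstd : StandardSet inv Sv F) (hsys : IsSepSys inv Sv)
    (hFsmall : ∀ s ∈ Sv, SmallSep inv s → ({inv s} : Set U) ∈ F)
    {A A' : Set U} {r : U} (hr : r ∈ Sv) (hrF : ({r} : Set U) ∉ F)
    (hA' : ∀ z ∈ A', z = r ∨ Drv inv F A z) {x : U} (hx : Drv inv F A' x) :
    Drv inv F A x ∨ (x ≤ r ∧ (Drv inv F A (inv x) → Drv inv F A (inv r))) := by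
  induction hx with
  | leaf x hx =>
    rcases hA' x hx with rfl | h
    · exact .inr ⟨le_rfl, id⟩
    · exact .inl h
  | node τ x hτ hxτ hch ih =>
    obtain ⟨hτS, hτnd, hτstar⟩ := hFstar τ hτ
    by_cases hall : ∀ y ∈ τ, y ≠ x → Drv inv F A (inv y)
    · exact .inl (.node τ x hτ hxτ hall)
    push Not at hall
    obtain ⟨y, hy, hyx, hyD⟩ := hall
    obtain ⟨hyr, hyi⟩ := (ih y hy hyx).resolve_left hyD
    rw [hinv.1] at hyi
    refine .inr ⟨(hτstar x hxτ y hy (Ne.symm hyx)).trans hyr, fun hxD => hyi ?_⟩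
    refine .node τ y hτ hy fun w hw hwy => ?_
    by_cases hwx : w = x
    · rwa [hwx]
    by_contra hwD
    obtain ⟨hwr, -⟩ := (ih w hw hwx).resolve_left hwD
    have hyr' : y ≤ r := (hτstar y hy w hw (Ne.symm hwy)).trans hwr
    have hsm : ¬ SmallSep inv (inv r) := fun h => by
      have := hFsmall (inv r) (hsys r hr) h
      rw [hinv.1] at this
      exact hrF this
    have h1 : inv r ≤ y := hinv.inv_le_comm.1 hyr
    have h2 : inv r ≤ inv y := hinv.2 _ _ hyr'
    apply hrF
    have := hFstd (inv r) (hsys r hr) ⟨y, hτS hy, fun hEq => ?_,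
      lt_of_le_of_ne h1 ?_, lt_of_le_of_ne h2 ?_⟩
    · rwa [hinv.1] at this
    · have : y ∈ ({inv r, inv (inv r)} : Set U) := hEq ▸ (by simp)
      apply hsm
      rw [SmallSep, hinv.1]
      rcases this with h | h
      · exact h ▸ hyr'
      · rw [Set.mem_singleton_iff, hinv.1] at h
        exact h ▸ h1
    · intro h
      exact hsm (by rw [SmallSep, hinv.1]; exact h ▸ hyr')
    · intro h
      exact hsm (by rw [SmallSep, hinv.1, h]; exact hyr)

/-- `A` is an up-closed subset of `Sv`. -/
def UpIn (Sv A : Set U) : Prop := A ⊆ Sv ∧ ∀ a ∈ A, ∀ b ∈ Sv, a ≤ b → b ∈ A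

/-- Two derivable separations cannot point away from each other if no separation is derivable
in both orientations. -/
theorem Drv.not_both_of_le (hinv : IsInvol inv) (hfin : Sv.Finite) (hsys : IsSepSys inv Sv)
    (hsub : SubmodularSys Sv)
    (hFstar : ∀ σ ∈ F, IsStarIn inv Sv σ)
    (hFstd : StandardSet inv Sv F) (hFshift : ClosedUnderShifting inv Sv F)
    (hFsmall : ∀ s ∈ Sv, SmallSep inv s → ({inv s} : Set U) ∈ F)
    {A : Set U} (hA : UpIn Sv A) (hno : ∀ x, Drv inv F A x → ¬ Drv inv F A (inv x))
    {a b : U} (ha : Drv inv F A a) (hb : Drv inv F A b) : ¬ a ≤ inv b := by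
  intro hab
  have haS := ha.mem hFstar hA.1
  have hbS := hb.mem hFstar hA.1
  have hnt : ∀ c, Drv inv F A c → c ∈ Sv → ¬ IsTrivialIn inv Sv c := fun c hc hcS ht =>
    hno c hc (.of_singleton (hFstd c hcS ht))
  obtain ⟨s, hsS, has, hsb, hsup, hinf⟩ := hsub.exists_between hfin haS hab
  have hbs : b ≤ inv s := hinv.le_inv_comm.1 hsb
  have hupA : ∀ s, (∀ z ∈ A, z ⊔ s ∈ Sv → Drv inv F A (z ⊔ s)) := fun s z hz hzs =>
    .leaf _ (hA.2 z hz _ hzs le_sup_left)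
  have hsup' : ∀ x ∈ Sv, b ≤ x → inv s ⊔ x ∈ Sv := fun x hx hbx => by
    have := hsys _ (hinf (inv x) (hsys x hx) (hinv.2 _ _ hbx))
    rwa [hinv.inv_inf, hinv.1] at this
  have h1 := Drv.shift hinv hsys hFstar hFshift hFsmall haS hsS (hnt a ha haS) has hsup
    (A' := A) (fun z hz haz => hupA s z hz (by rw [sup_comm]; exact hsup z (hA.1 hz) haz)) ha le_rfl
  have h2 := Drv.shift hinv hsys hFstar hFshift hFsmall hbS (hsys s hsS) (hnt b hb hbS) hbs hsup'
    (A' := A) (fun z hz haz => hupA _ z hz (by rw [sup_comm]; exact hsup' z (hA.1 hz) haz))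
    hb le_rfl
  rw [sup_eq_right.2 has, or_self] at h1
  rw [sup_eq_right.2 hbs, or_self] at h2
  exact hno s h1 h2

/-- Tangle-tree duality, with up-closed sets of leaves. -/
theorem exists_tangle_of_not_drv (hinv : IsInvol inv) (hfin : Sv.Finite) (hsys : IsSepSys inv Sv)
    (hsub : SubmodularSys Sv)
    (hFstar : ∀ σ ∈ F, IsStarIn inv Sv σ)
    (hFstd : StandardSet inv Sv F) (hFshift : ClosedUnderShifting inv Sv F)
    (hFsmall : ∀ s ∈ Sv, SmallSep inv s → ({inv s} : Set U) ∈ F) (hFempty : ∅ ∉ F)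
    {A : Set U} (hA : UpIn Sv A) (hno : ∀ x, Drv inv F A x → ¬ Drv inv F A (inv x)) :
    ∃ O, IsFTangle inv Sv F O ∧ Disjoint O A := by
  obtain ⟨B, hAB, ⟨hB, hBno⟩, hmax⟩ := Set.Finite.exists_le_maximal
    (s := {B | UpIn Sv B ∧ ∀ x, Drv inv F B x → ¬ Drv inv F B (inv x)})
    (hfin.finite_subsets.subset fun B hB => hB.1.1) (a := A) ⟨hA, hno⟩
  have hle : ∀ {a b}, Drv inv F B a → Drv inv F B b → ¬ a ≤ inv b :=
    Drv.not_both_of_le hinv hfin hsys hsub hFstar hFstd hFshift hFsmall hB hBno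
  have hext : ∀ r ∈ Sv, ¬ Drv inv F B r → (∀ x ∈ Sv, r < x → Drv inv F B x) →
      Drv inv F B (inv r) := by
    intro r hr hrD hrx
    by_contra hrD'
    have hdrv {x : U} := Drv.of_insert hinv hFstar hFstd hsys hFsmall (A := B)
      (A' := B ∪ {x ∈ Sv | r ≤ x}) hr (fun h => hrD (.of_singleton h)) (by
        rintro z (hz | ⟨hz, hrz⟩)
        · exact .inr (.leaf z hz)
        · rcases hrz.eq_or_lt with h | h
          · exact .inl h.symm
          · exact .inr (hrx z hz h)) (x := x)
    have hB' : B ∪ {x ∈ Sv | r ≤ x} ⊆ B := hmax ⟨⟨?_, ?_⟩, ?_⟩ Set.subset_union_left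
    · exact hrD (.leaf r (hB' (.inr ⟨hr, le_rfl⟩)))
    · exact Set.union_subset hB.1 fun _ h => h.1
    · rintro a (ha | ⟨_, ha⟩) b hb hab
      · exact .inl (hB.2 a ha b hb hab)
      · exact .inr ⟨hb, ha.trans hab⟩
    · intro x hx hx'
      rcases hdrv hx with h | ⟨hxr, h⟩ <;> rcases hdrv hx' with h' | ⟨hxr', h'⟩
      · exact hBno x h h'
      · rw [hinv.1] at h'
        exact hrD' (h' h)
      · exact hrD' (h h')
      · have hsm : inv r ≤ r := (hinv.inv_le_comm.1 hxr').trans hxr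
        have := hFsmall (inv r) (hsys r hr) (by rwa [SmallSep, hinv.1])
        rw [hinv.1] at this
        exact hrD (.of_singleton this)
  have htot : ∀ r ∈ Sv, Drv inv F B r ∨ Drv inv F B (inv r) := by
    intro r hr
    by_contra! hcon
    obtain ⟨h1, h2⟩ := hcon
    have hmx : ∀ q ∈ Sv, ¬ Drv inv F B q → ∃ q', q ≤ q' ∧ Drv inv F B (inv q') := by
      intro q hq hqD
      obtain ⟨q', hqq', ⟨hq'S, hq'D⟩, hq'max⟩ := Set.Finite.exists_le_maximal
        (s := {x ∈ Sv | ¬ Drv inv F B x}) (hfin.subset fun _ h => h.1) (a := q) ⟨hq, hqD⟩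
      refine ⟨q', hqq', hext q' hq'S hq'D fun x hx hlt => ?_⟩
      by_contra hxD
      exact hlt.not_ge (hq'max ⟨hx, hxD⟩ hlt.le)
    obtain ⟨p, hp, hpD⟩ := hmx r hr h1
    obtain ⟨q, hq, hqD⟩ := hmx (inv r) (hsys r hr) h2
    refine hle hpD hqD ?_
    rw [hinv.1]
    exact (hinv.2 _ _ hp).trans hq
  refine ⟨{r ∈ Sv | ¬ Drv inv F B r}, ⟨⟨fun _ h => h.1, ?_, ?_⟩, ?_, ?_⟩, ?_⟩
  · intro s hs
    by_cases h : Drv inv F B s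
    · exact .inr ⟨hsys s hs, hBno s h⟩
    · exact .inl ⟨hs, h⟩
  · intro s hs hs'
    rcases htot s hs.1 with h | h
    · exact absurd h hs.2
    · exact absurd h hs'.2
  · intro a ha b hb _ hlt
    refine hle ((htot a ha.1).resolve_left ha.2) ((htot b hb.1).resolve_left hb.2) ?_
    rw [hinv.1]
    exact hlt.le
  · intro τ hτ hsub
    obtain ⟨z, hz⟩ := Set.nonempty_iff_ne_empty.2 (fun h : τ = ∅ => hFempty (h ▸ hτ))
    exact (hsub hz).2 (.node τ z hτ hz fun y hy _ => (htot y (hsub hy).1).resolve_left (hsub hy).2)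
  · exact Set.disjoint_left.2 fun x hx hxA => hx.2 (.leaf x (hAB hxA))

/-- In a tree, every tangle lives at some leaf, and the tree may be rerooted there. -/
theorem Drv.exists_leaf_mem {O A : Set U} (hinv : IsInvol inv)
    (hFstar : ∀ σ ∈ F, IsStarIn inv Sv σ) (hO : IsFTangle inv Sv F O) {x : U}
    (hx : Drv inv F A x) (hx' : Drv inv F A (inv x)) (hxO : x ∈ O) :
    ∃ a ∈ A, a ∈ O ∧ Drv inv F A (inv a) := by
  induction hx with
  | leaf x hx => exact ⟨x, hx, hxO, hx'⟩
  | node τ x hτ hxτ hch ih =>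
    obtain ⟨y, hy, hyO⟩ := Set.not_subset.1 (hO.2.2 τ hτ)
    have hyx : y ≠ x := fun h => hyO (h ▸ hxO)
    have hyO' : inv y ∈ O := (hO.mem_or_inv_mem ((hFstar τ hτ).1 hy)).resolve_left hyO
    refine ih y hy hyx ?_ hyO'
    rw [hinv.1]
    refine .node τ y hτ hy fun w hw _ => ?_
    by_cases hwx : w = x
    · rwa [hwx]
    · exact hch w hw hwx

/-- The star `σ` yields a tree all of whose leaves outside `F` are inverses of elements
of `σ`. -/
theorem exists_drv_inv_star (hinv : IsInvol inv) (hfin : Sv.Finite) (hsys : IsSepSys inv Sv)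
    (hsub : SubmodularSys Sv)
    (hFstar : ∀ σ ∈ F, IsStarIn inv Sv σ)
    (hFstd : StandardSet inv Sv F) (hFshift : ClosedUnderShifting inv Sv F)
    (hFsmall : ∀ s ∈ Sv, SmallSep inv s → ({inv s} : Set U) ∈ F) (hFempty : ∅ ∉ F)
    {σ : Set U} (hσstar : IsStarIn inv Sv σ)
    (hσiness : ∀ O, IsFTangle inv Sv F O → ¬ σ ⊆ O)
    (hσCR : ∀ s ∈ σ, ∃ O, IsFTangle inv Sv F O ∧ CloselyRelated inv Sv O (inv s)) :
    ∃ x, Drv inv F (inv '' σ) x ∧ Drv inv F (inv '' σ) (inv x) := by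
  let A : Set U → Set U := fun B => {z ∈ Sv | ∃ s ∈ σ, inv s ≤ z ∧ (s ∈ B → z = inv s)}
  have hAS : ∀ B, A B ⊆ Sv := fun B _ h => h.1
  have key : ∃ x, Drv inv F (A σ) x ∧ Drv inv F (A σ) (inv x) := by
    refine Set.Finite.induction_on_subset
      (motive := fun B _ => ∃ x, Drv inv F (A B) x ∧ Drv inv F (A B) (inv x)) σ
      (hfin.subset hσstar.1) ?_ ?_
    · by_contra! hno
      obtain ⟨O, hO, hdisj⟩ := exists_tangle_of_not_drv hinv hfin hsys hsub hFstar hFstd hFshift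
        hFsmall hFempty (A := A ∅) ⟨hAS _, by
          rintro a ⟨_, s, hs, hsa, -⟩ b hb hab
          exact ⟨hb, s, hs, hsa.trans hab, by simp⟩⟩ hno
      refine hσiness O hO fun s hs => (hO.mem_or_inv_mem (hσstar.1 hs)).resolve_right fun h => ?_
      exact Set.disjoint_left.1 hdisj h ⟨hsys s (hσstar.1 hs), s, hs, le_rfl, by simp⟩
    · rintro s B hs - hsB ⟨x, hx, hx'⟩
      have hsS := hσstar.1 hs
      obtain ⟨O, hO, hsO, hcl⟩ := hσCR s hs
      have hnle {a b : U} (ha : a ∈ O) (hb : b ∈ O) : ¬ inv a ≤ b :=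
        hO.not_inv_le hinv hsys hFsmall ha hb
      obtain ⟨a, haA, haO, haD⟩ : ∃ a ∈ A B, a ∈ O ∧ Drv inv F (A B) (inv a) := by
        rcases hO.mem_or_inv_mem (hx.mem hFstar (hAS B)) with h | h
        · exact hx.exists_leaf_mem hinv hFstar hO hx' h
        · exact hx'.exists_leaf_mem hinv hFstar hO (by rwa [hinv.1]) h
      have has : inv s ≤ a := by
        obtain ⟨_, j, hj, hja, -⟩ := haA
        by_cases hjs : j = s
        · rwa [← hjs]
        · exact absurd ((hinv.inv_le_comm.1 hja).trans (hσstar.2.2 j hj s hs hjs)) (hnle haO hsO)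
      have haS : a ∈ Sv := haA.1
      have has' : inv a ≤ s := hinv.inv_le_comm.1 has
      have hem : ∀ y ∈ Sv, inv a ≤ y → s ⊔ y ∈ Sv := by
        intro y hy hay
        have hyO : inv y ∈ O := (hO.mem_or_inv_mem hy).resolve_left fun h => hnle haO h hay
        have := hsys _ (hcl _ hyO)
        rwa [hinv.inv_inf, hinv.1, hinv.1] at this
      have hnt : ¬ IsTrivialIn inv Sv (inv a) := fun h => by
        have := hFstd _ (hsys a haS) h
        rw [hinv.1] at this
        exact hO.2.2 _ this (by simpa using haO)
      refine ⟨s, ?_, .leaf _ ⟨hsys s hsS, s, hs, le_rfl, fun _ => rfl⟩⟩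
      have := Drv.shift hinv hsys hFstar hFshift hFsmall (hsys a haS) hsS hnt has' hem
        (A' := A (insert s B)) ?_ haD le_rfl
      · rwa [sup_eq_right.2 has', or_self] at this
      rintro z ⟨hzS, j, hj, hjz, hjB⟩ haz
      have hzs : z ⊔ s ∈ Sv := by
        rw [sup_comm]
        exact hem z hzS haz
      by_cases hjs : j = s
      · subst hjs
        have := hFsmall (inv (z ⊔ j)) (hsys _ hzs) (by
          rw [SmallSep, hinv.1]
          exact ((hinv.2 _ _ le_sup_left).trans (hinv.inv_le_comm.1 hjz)).trans le_sup_right)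
        rw [hinv.1] at this
        exact .of_singleton this
      · refine .leaf _ ⟨hzs, j, hj, hjz.trans le_sup_left, ?_⟩
        rintro (h | h)
        · exact absurd h hjs
        · rw [hjB h, sup_eq_left]
          exact hσstar.2.2 s hs j hj (Ne.symm hjs)
  have hAσ : A σ = inv '' σ := by
    ext z
    constructor
    · rintro ⟨_, s, hs, -, h⟩
      exact ⟨s, hs, (h hs).symm⟩
    · rintro ⟨s, hs, rfl⟩
      exact ⟨hsys s (hσstar.1 hs), s, hs, le_rfl, fun _ => rfl⟩
  rwa [hAσ] at key

end Order

section Tree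

open SimpleGraph

theorem isAcyclic_sum {V W : Type*} {G : SimpleGraph V} {H : SimpleGraph W}
    (hG : G.IsAcyclic) (hH : H.IsAcyclic) : (G ⊕g H).IsAcyclic := by
  have hl : ∀ (p q : V) (x y : V ⊕ W), ((G ⊕g H).deleteEdges {s(.inl p, .inl q)}).Walk x y →
      ∀ a, x = .inl a → ∃ c, y = .inl c ∧ (G.deleteEdges {s(p, q)}).Reachable a c := by
    intro p q x y w
    induction w with
    | nil => exact fun a h => ⟨a, h, .rfl⟩
    | cons h _ ih =>
      rintro a rfl
      rename_i v _ _
      rcases v with v | v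
      · obtain ⟨c, hc, hr⟩ := ih v rfl
        refine ⟨c, hc, Reachable.trans (Adj.reachable ?_) hr⟩
        simpa using h
      · simp at h
  have hr : ∀ (p q : W) (x y : V ⊕ W), ((G ⊕g H).deleteEdges {s(.inr p, .inr q)}).Walk x y →
      ∀ a, x = .inr a → ∃ c, y = .inr c ∧ (H.deleteEdges {s(p, q)}).Reachable a c := by
    intro p q x y w
    induction w with
    | nil => exact fun a h => ⟨a, h, .rfl⟩
    | cons h _ ih =>
      rintro a rfl
      rename_i v _ _
      rcases v with v | v
      · simp at h
      · obtain ⟨c, hc, hr⟩ := ih v rfl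
        refine ⟨c, hc, Reachable.trans (Adj.reachable ?_) hr⟩
        simpa using h
  rw [isAcyclic_iff_forall_adj_isBridge] at hG hH ⊢
  rintro (p | p) (q | q) hpq
  · have := hG (by simpa using hpq : G.Adj p q)
    rw [isBridge_iff] at this ⊢
    rintro ⟨w⟩
    obtain ⟨c, hc, hr⟩ := hl p q _ _ w p rfl
    obtain rfl := Sum.inl_injective hc
    exact this hr
  · simp at hpq
  · simp at hpq
  · have := hH (by simpa using hpq : H.Adj p q)
    rw [isBridge_iff] at this ⊢
    rintro ⟨w⟩
    obtain ⟨c, hc, hr⟩ := hr p q _ _ w p rfl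
    obtain rfl := Sum.inr_injective hc
    exact this hr

/-- Joining two disjoint trees by an edge yields a tree. -/
theorem isTree_sum_sup_edge {V W : Type*} {G : SimpleGraph V} {H : SimpleGraph W}
    (hG : G.IsTree) (hH : H.IsTree) (a : V) (b : W) :
    ((G ⊕g H) ⊔ edge (.inl a) (.inr b)).IsTree := by
  refine ⟨?_, (isAcyclic_sum hG.isAcyclic hH.isAcyclic).sup_edge_of_not_reachable
    (not_reachable_sum_inl_inr a b)⟩
  have hab : ((G ⊕g H) ⊔ edge (.inl a) (.inr b)).Adj (.inl a) (.inr b) := by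
    simp [edge_adj]
  have hl : ∀ v, ((G ⊕g H) ⊔ edge (.inl a) (.inr b)).Reachable (.inl v) (.inl a) := fun v =>
    ((hG.connected v a).map Embedding.sumInl.toHom).mono le_sup_left
  have hr : ∀ v, ((G ⊕g H) ⊔ edge (.inl a) (.inr b)).Reachable (.inr v) (.inl a) := fun v =>
    (((hH.connected v b).map Embedding.sumInr.toHom).mono le_sup_left).trans hab.symm.reachable
  have hall : ∀ x, ((G ⊕g H) ⊔ edge (.inl a) (.inr b)).Reachable x (.inl a) := by
    rintro (v | v)
    exacts [hl v, hr v]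
  exact { preconnected := fun x y => (hall x).trans (hall y).symm, nonempty := ⟨.inl a⟩ }

variable {U : Type*}

/-- The star of separations pointing towards the vertex `v`. -/
def inStar {V : Type} (T : SimpleGraph V) (α : V → V → U) (v : V) : Set U :=
  {x | ∃ t, T.Adj t v ∧ x = α t v}

/-- There is a finite tree with edges labelled by separations in `Sv`, in which distinct edges at a
vertex have distinct labels, whose root has star `P`, whose other vertices have stars in `F`, and
in which each `{a}` with `a ∈ W` is the star of some vertex other than the root. -/
def HasRootedTree (inv : U → U) (Sv : Set U) (F : Set (Set U)) (P W : Set U) : Prop :=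
  ∃ (V : Type) (_ : Fintype V) (T : SimpleGraph V) (_ : T.IsTree) (α : V → V → U) (o : V),
    (∀ t t', T.Adj t t' → α t t' ∈ Sv) ∧
    (∀ t t', T.Adj t t' → α t' t = inv (α t t')) ∧
    (∀ v t t', T.Adj t v → T.Adj t' v → α t v = α t' v → t = t') ∧
    inStar T α o = P ∧ (∀ v, v ≠ o → inStar T α v ∈ F) ∧
    ∀ a ∈ W, ∃ v, v ≠ o ∧ inStar T α v = {a}

/-- The labelling of two trees joined by an edge that is labelled by `x` and `y`. -/
def glueLabel {V W : Type} (α : V → V → U) (β : W → W → U) (x y : U) : V ⊕ W → V ⊕ W → U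
  | .inl a, .inl b => α a b
  | .inr a, .inr b => β a b
  | .inl _, .inr _ => x
  | .inr _, .inl _ => y

variable {inv : U → U} {Sv : Set U} {F : Set (Set U)}

theorem hasRootedTree_empty [Nonempty U] : HasRootedTree inv Sv F ∅ ∅ :=
  ⟨Unit, inferInstance, ⊥, .of_subsingleton, fun _ _ => Classical.arbitrary U, (),
    by simp, by simp, by simp, by simp [inStar], by simp, by simp⟩

theorem HasRootedTree.glue (hinv : ∀ s, inv (inv s) = s) (hsys : IsSepSys inv Sv)
    {P Q W W' W'' : Set U} {y : U} (hP : HasRootedTree inv Sv F P W)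
    (hQ : HasRootedTree inv Sv F Q W') (hy : y ∈ Sv) (hyP : y ∉ P) (hyQ : inv y ∉ Q)
    (hQF : insert (inv y) Q ∈ F)
    (hW : ∀ a ∈ W'', a ∈ W ∨ a ∈ W' ∨ insert (inv y) Q = {a}) :
    HasRootedTree inv Sv F (insert y P) W'' := by
  obtain ⟨V₁, _, T₁, hT₁, α, o₁, hS₁, hI₁, hJ₁, rfl, hF₁, hW₁⟩ := hP
  obtain ⟨V₂, _, T₂, hT₂, β, o₂, hS₂, hI₂, hJ₂, rfl, hF₂, hW₂⟩ := hQ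
  set K := (T₁ ⊕g T₂) ⊔ edge (.inl o₁) (.inr o₂) with hK
  have hll : ∀ a b, K.Adj (.inl a) (.inl b) ↔ T₁.Adj a b := by simp [hK, edge_adj]
  have hrr : ∀ a b, K.Adj (.inr a) (.inr b) ↔ T₂.Adj a b := by simp [hK, edge_adj]
  have hlr : ∀ a b, K.Adj (.inl a) (.inr b) ↔ a = o₁ ∧ b = o₂ := by simp [hK, edge_adj]
  have hrl : ∀ a b, K.Adj (.inr a) (.inl b) ↔ a = o₂ ∧ b = o₁ := by simp [hK, edge_adj]
  let γ := glueLabel α β (inv y) y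
  have hl : ∀ v, v ≠ o₁ → inStar K γ (.inl v) = inStar T₁ α v := by
    intro v hv
    ext x
    simp [inStar, hll, hrl, hv, γ, glueLabel]
  have hr : ∀ v, v ≠ o₂ → inStar K γ (.inr v) = inStar T₂ β v := by
    intro v hv
    ext x
    simp [inStar, hrr, hlr, hv, γ, glueLabel]
  have hlo : inStar K γ (.inl o₁) = insert y (inStar T₁ α o₁) := by
    ext x
    simp [inStar, hll, hrl, γ, glueLabel, or_comm]
  have hro : inStar K γ (.inr o₂) = insert (inv y) (inStar T₂ β o₂) := by
    ext x
    simp [inStar, hrr, hlr, γ, glueLabel]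
  refine ⟨V₁ ⊕ V₂, inferInstance, K, isTree_sum_sup_edge hT₁ hT₂ o₁ o₂, γ, .inl o₁,
    ?_, ?_, ?_, hlo, ?_, ?_⟩
  · rintro (t | t) (t' | t') h
    · exact hS₁ t t' ((hll _ _).1 h)
    · exact hsys y hy
    · exact hy
    · exact hS₂ t t' ((hrr _ _).1 h)
  · rintro (t | t) (t' | t') h
    · exact hI₁ t t' ((hll _ _).1 h)
    · exact (hinv y).symm
    · rfl
    · exact hI₂ t t' ((hrr _ _).1 h)
  · rintro (v | v) (t | t) (t' | t') h h' heq
    · exact congrArg _ (hJ₁ v t t' ((hll _ _).1 h) ((hll _ _).1 h') heq)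
    · obtain ⟨rfl, rfl⟩ := (hrl _ _).1 h'
      exact absurd ⟨t, (hll _ _).1 h, heq.symm⟩ hyP
    · obtain ⟨rfl, rfl⟩ := (hrl _ _).1 h
      exact absurd ⟨t', (hll _ _).1 h', heq⟩ hyP
    · rw [((hrl _ _).1 h).1, ((hrl _ _).1 h').1]
    · rw [((hlr _ _).1 h).1, ((hlr _ _).1 h').1]
    · obtain ⟨rfl, rfl⟩ := (hlr _ _).1 h
      exact absurd ⟨t', (hrr _ _).1 h', heq⟩ hyQ
    · obtain ⟨rfl, rfl⟩ := (hlr _ _).1 h'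
      exact absurd ⟨t, (hrr _ _).1 h, heq.symm⟩ hyQ
    · exact congrArg _ (hJ₂ v t t' ((hrr _ _).1 h) ((hrr _ _).1 h') heq)
  · rintro (v | v) hv
    · have hv' : v ≠ o₁ := fun h => hv (h ▸ rfl)
      rw [hl v hv']
      exact hF₁ v hv'
    · by_cases hv' : v = o₂
      · rw [hv', hro]
        exact hQF
      · rw [hr v hv']
        exact hF₂ v hv'
  · intro a ha
    rcases hW a ha with h | h | h
    · obtain ⟨v, hv, hva⟩ := hW₁ a h
      exact ⟨.inl v, by simpa using hv, by rw [hl v hv, hva]⟩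
    · obtain ⟨v, hv, hva⟩ := hW₂ a h
      exact ⟨.inr v, by simp, by rw [hr v hv, hva]⟩
    · exact ⟨.inr o₂, by simp, by rw [hro, h]⟩

/-- A branch entered through `x`: a rooted tree whose root star is completed by `x` to an element
of `F`, and which has a leaf with star `{inv s}` for every `s` with `x ∈ O s`. -/
def HasBranch (inv : U → U) (Sv : Set U) (F : Set (Set U)) (σ : Set U) (O : U → Set U)
    (x : U) : Prop :=
  ∃ Q W, x ∉ Q ∧ insert x Q ∈ F ∧ HasRootedTree inv Sv F Q W ∧
    ∀ s ∈ σ, x ∈ O s → inv s ∈ W ∨ insert x Q = {inv s}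

theorem hasRootedTree_of_hasBranch [Nonempty U] (hinv : ∀ s, inv (inv s) = s) (hsys : IsSepSys inv Sv)
    {σ : Set U} {O : U → Set U} {P : Set U} (hfin : P.Finite) (hPS : P ⊆ Sv)
    (hP : ∀ y ∈ P, HasBranch inv Sv F σ O (inv y)) :
    HasRootedTree inv Sv F P {a | ∃ s ∈ σ, a = inv s ∧ ∃ y ∈ P, inv y ∈ O s} := by
  refine Set.Finite.induction_on_subset (motive := fun P _ =>
    HasRootedTree inv Sv F P {a | ∃ s ∈ σ, a = inv s ∧ ∃ y ∈ P, inv y ∈ O s}) P hfin ?_ ?_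
  · simpa using hasRootedTree_empty
  · intro y B hy hBP hyB ih
    obtain ⟨Q, W, hyQ, hQF, hQ, hW⟩ := hP y hy
    refine ih.glue hinv hsys hQ (hPS hy) hyB hyQ hQF ?_
    rintro _ ⟨s, hs, rfl, z, hz | hz, hzO⟩
    · exact .inr (hW s hs (hz ▸ hzO))
    · exact .inl ⟨s, hs, rfl, z, hz, hzO⟩

end Tree

section Final

variable {U : Type*} [Lattice U] {inv : U → U} {Sv : Set U} {F : Set (Set U)}

theorem Drv.hasBranch (hinv : ∀ s, inv (inv s) = s) (hfin : Sv.Finite) (hsys : IsSepSys inv Sv)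
    (hFstar : ∀ σ ∈ F, IsStarIn inv Sv σ) {σ : Set U} {O : U → Set U}
    (hO : ∀ s ∈ σ, IsFTangle inv Sv F (O s)) (hσO : ∀ s ∈ σ, ∀ j ∈ σ, inv j ∈ O s → j = s)
    {x : U} (hx : Drv inv F (inv '' σ) x) :
    HasBranch inv Sv (F ∪ {τ | ∃ s ∈ σ, τ = {inv s}}) σ O x := by
  have : Nonempty U := ⟨x⟩
  induction hx with
  | leaf x hx =>
    obtain ⟨j, hj, rfl⟩ := hx
    refine ⟨∅, ∅, by simp, .inr ⟨j, hj, by simp⟩, hasRootedTree_empty, fun s hs h => .inr ?_⟩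
    rw [hσO s hs j hj h]
    simp
  | node τ x hτ hxτ hch ih =>
    have hτS := (hFstar τ hτ).1
    have hins : insert x (τ \ {x}) = τ := by simp [Set.insert_eq_of_mem hxτ]
    refine ⟨τ \ {x}, _, by simp, by rw [hins]; exact .inl hτ,
      hasRootedTree_of_hasBranch (σ := σ) (O := O) hinv hsys (hfin.subset (Set.sdiff_subset.trans hτS))
      (Set.sdiff_subset.trans hτS) fun y hy => ih y hy.1 hy.2, fun s hs hxs => .inl ?_⟩
    obtain ⟨y, hy, hyO⟩ := Set.not_subset.1 ((hO s hs).2.2 τ hτ)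
    exact ⟨s, hs, rfl, y, ⟨hy, fun h => hyO (h ▸ hxs)⟩,
      ((hO s hs).mem_or_inv_mem (hτS hy)).resolve_left hyO⟩

theorem exists_rootedTree (hinv : ∀ s, inv (inv s) = s) (hfin : Sv.Finite) (hsys : IsSepSys inv Sv)
    (hFstar : ∀ σ ∈ F, IsStarIn inv Sv σ) {σ : Set U} (hσ : σ ⊆ Sv) {O : U → Set U}
    (hO : ∀ s ∈ σ, IsFTangle inv Sv F (O s)) (hσO : ∀ s ∈ σ, ∀ j ∈ σ, inv j ∈ O s → j = s)
    {x : U} (hx : Drv inv F (inv '' σ) x) (hx' : Drv inv F (inv '' σ) (inv x)) :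
    ∃ P W, P ∈ F ∪ {τ | ∃ s ∈ σ, τ = {inv s}} ∧
      HasRootedTree inv Sv (F ∪ {τ | ∃ s ∈ σ, τ = {inv s}}) P W ∧
      ∀ s ∈ σ, inv s ∈ W ∨ P = {inv s} := by
  have : Nonempty U := ⟨x⟩
  have hbr {z : U} (hz : Drv inv F (inv '' σ) z) := hz.hasBranch hinv hfin hsys hFstar hO hσO
  cases hx with
  | leaf _ h =>
    obtain ⟨j, hj, rfl⟩ := h
    have hjS := hsys j (hσ hj)
    refine ⟨{inv j}, _, .inr ⟨j, hj, rfl⟩, hasRootedTree_of_hasBranch (σ := σ) (O := O)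
      (P := {inv j}) hinv hsys (Set.finite_singleton _) (by simpa using hjS) ?_, fun s hs => ?_⟩
    · rintro y rfl
      exact hbr hx'
    · rcases (hO s hs).mem_or_inv_mem hjS with h | h
      · exact .inr (by rw [hσO s hs j hj h])
      · exact .inl ⟨s, hs, rfl, inv j, rfl, h⟩
  | node τ _ hτ hxτ hch =>
    have hτS := (hFstar τ hτ).1
    refine ⟨τ, _, .inl hτ, hasRootedTree_of_hasBranch (σ := σ) (O := O) hinv hsys (hfin.subset hτS) hτS
      fun y hy => ?_, fun s hs => .inl ?_⟩
    · by_cases hyx : y = x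
      · exact hyx ▸ hbr hx'
      · exact hbr (hch y hy hyx)
    · obtain ⟨y, hy, hyO⟩ := Set.not_subset.1 ((hO s hs).2.2 τ hτ)
      exact ⟨s, hs, rfl, y, hy, ((hO s hs).mem_or_inv_mem (hτS hy)).resolve_left hyO⟩

end Final

end SepSys

open SepSys

theorem refining_lemma_abstract {U : Type*} [Lattice U] (inv : U → U) (Sv : Set U)
    (hinv : IsInvol inv) (hfin : Sv.Finite) (hsys : IsSepSys inv Sv)
    (hsub : SubmodularSys Sv)
    (F : Set (Set U)) (hFstar : ∀ σ ∈ F, IsStarIn inv Sv σ)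
    (hFstd : StandardSet inv Sv F) (hFshift : ClosedUnderShifting inv Sv F)
    (hFsmall : ∀ s ∈ Sv, SmallSep inv s → ({inv s} : Set U) ∈ F)
    (σ : Set U) (hσstar : IsStarIn inv Sv σ) (hσne : σ.Nonempty)
    (hσiness : ∀ O, IsFTangle inv Sv F O → ¬ σ ⊆ O)
    (hσCR : ∀ s ∈ σ, ∃ O, IsFTangle inv Sv F O ∧ CloselyRelated inv Sv O (inv s)) :
    ∃ (V : Type) (_ : Fintype V) (T : SimpleGraph V) (_ : T.IsTree) (α : V → V → U),
      (∀ t t' : V, T.Adj t t' → α t t' ∈ Sv) ∧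
      (∀ t t' : V, T.Adj t t' → α t' t = inv (α t t')) ∧
      (∀ t : V, {x : U | ∃ t' : V, T.Adj t' t ∧ x = α t' t} ∈
        F ∪ {τ : Set U | ∃ s ∈ σ, τ = ({inv s} : Set U)}) ∧
      ∀ s ∈ σ, ∃ x t : V, T.Adj x t ∧ (∀ y : V, T.Adj x y → y = t) ∧ α x t = s := by
  obtain ⟨s₀, hs₀⟩ := hσne
  have hFempty : ∅ ∉ F := fun h => by
    obtain ⟨O, hO, -⟩ := hσCR s₀ hs₀
    exact hO.2.2 ∅ h (Set.empty_subset O)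
  obtain ⟨x, hx, hx'⟩ := exists_drv_inv_star hinv hfin hsys hsub hFstar hFstd hFshift hFsmall
    hFempty hσstar hσiness hσCR
  choose! O hO hOcl using hσCR
  have hσO : ∀ s ∈ σ, ∀ j ∈ σ, inv j ∈ O s → j = s := fun s hs j hj h => by
    by_contra hjs
    refine (hO s hs).not_inv_le hinv hsys hFsmall h (hOcl s hs).1 ?_
    rw [hinv.1]
    exact hσstar.2.2 j hj s hs hjs
  obtain ⟨P, W, hP, ⟨V, hV, T, hT, α, o, hS, hI, hJ, hoP, hF, hW⟩, hall⟩ :=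
    exists_rootedTree hinv.1 hfin hsys hFstar hσstar.1 hO hσO hx hx'
  refine ⟨V, hV, T, hT, α, hS, hI, fun t => ?_, fun s hs => ?_⟩
  · by_cases ht : t = o
    · subst ht
      rw [← hoP] at hP
      exact hP
    · exact hF t ht
  · obtain ⟨v, hv⟩ : ∃ v, inStar T α v = {inv s} := by
      rcases hall s hs with h | h
      · obtain ⟨v, -, hv⟩ := hW _ h
        exact ⟨v, hv⟩
      · exact ⟨o, hoP.trans h⟩
    obtain ⟨t, htv, ht⟩ : inv s ∈ inStar T α v := hv ▸ rfl
    refine ⟨v, t, htv.symm, fun y hy => ?_, ?_⟩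
    · have hyv : α y v ∈ inStar T α v := ⟨y, hy.symm, rfl⟩
      rw [hv] at hyv
      exact hJ v y t hy.symm htv (hyv.trans ht)
    · rw [hI t v htv, ← ht, hinv.1]
end

section
/- Let S⃗ be a finite submodular separation system inside a universe of separations, and let P be a profile of S. Then every oriented separation s ∈ P that is a maximal element of P (with respect to the partial order induced by S⃗) is closely related to P. -/
open SepSys

theorem maximal_implies_closely_related {U : Type*} [Lattice U] (inv : U → U) (Sv : Set U)
    (hinv : IsInvol inv) (hfin : Sv.Finite) (hsys : IsSepSys inv Sv)
    (hsub : SubmodularSys Sv)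
    (P : Set U) (hP : IsProfile inv Sv P)
    (s : U) (hs : s ∈ P) (hmax : ∀ r ∈ P, s ≤ r → s = r) :
    CloselyRelated inv Sv P s := by
  obtain ⟨⟨hPS, hor, _⟩, _, hprof⟩ := hP
  refine ⟨hs, fun r hr => ?_⟩
  rcases hsub s (hPS hs) r (hPS hr) with h | h
  · have hmem : s ⊔ r ∈ P := (hor _ h).resolve_right (hprof s hs r hr)
    have hrs : r ≤ s := sup_eq_left.mp (hmax _ hmem le_sup_left).symm
    rw [inf_eq_right.mpr hrs]
    exact hPS hr
  · exact h
end

section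
/- Let U⃗ be a submodular universe of separations, let k be a positive integer, and let P and P' be two profiles of S_k. If an oriented separation s ∈ P distinguishes P and P' efficiently, then s is closely related to P and its inverse s* is closely related to P'. -/
open SepSys

/-- If no separation of smaller order than `s` distinguishes `P` from `P'`, where `s ∈ P` and
`inv s ∈ P'`, then `s` is closely related to `P`. -/
theorem SepSys.closelyRelated_of_efficient {U : Type*} [Lattice U] {inv : U → U}
    (hinv : IsInvol inv) {ord : U → ℝ} (hordinv : ∀ s : U, ord (inv s) = ord s)
    (hordsub : ∀ r s : U, ord (r ⊔ s) + ord (r ⊓ s) ≤ ord r + ord s)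
    {k : ℝ} {P P' : Set U} (hP : IsProfile inv {s : U | ord s < k} P)
    (hP' : IsOrientation inv {s : U | ord s < k} P') (hcons : Consistent inv P')
    {s : U} (hs : s ∈ P) (hs' : inv s ∈ P')
    (heff : ∀ t ∈ {s : U | ord s < k}, ord t < ord s → ¬ Distinguishes inv t P P') :
    CloselyRelated inv {s : U | ord s < k} P s := by
  obtain ⟨⟨hsub, htotal, -⟩, -, hprof⟩ := hP
  refine ⟨hs, fun r hr => ?_⟩
  by_contra hinf
  have hinf_ge : k ≤ ord (s ⊓ r) := not_lt.mp hinf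
  have hr_lt : ord r < k := hsub hr
  have hsup_lt : ord (s ⊔ r) < ord s := by linarith [hordsub s r]
  have hsup_mem : s ⊔ r ∈ {s : U | ord s < k} := hsup_lt.trans (hsub hs)
  have hnot : inv (s ⊔ r) ∉ P := hprof s hs r hr
  have hsupP : s ⊔ r ∈ P := (htotal _ hsup_mem).resolve_right hnot
  have hsupP' : s ⊔ r ∉ P' := by
    intro h
    refine hcons _ h _ hs' (fun heq => ?_) (lt_of_le_of_ne (hinv.2 _ _ le_sup_left) fun heq => ?_)
    · rw [heq, hordinv] at hsup_lt
      exact hsup_lt.false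
    · rw [← hordinv (s ⊔ r), heq, hordinv] at hsup_lt
      exact hsup_lt.false
  exact heff _ hsup_mem hsup_lt
    ⟨fun h => hnot (h.symm ▸ hsupP), .inl ⟨hsupP, (hP'.2.1 _ hsup_mem).resolve_left hsupP'⟩⟩

theorem efficient_implies_closely_related {U : Type*} [Lattice U] [Fintype U]
    (inv : U → U) (hinv : IsInvol inv)
    (ord : U → ℝ) (hord0 : ∀ s : U, 0 ≤ ord s) (hordinv : ∀ s : U, ord (inv s) = ord s)
    (hordsub : ∀ r s : U, ord (r ⊔ s) + ord (r ⊓ s) ≤ ord r + ord s)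
    (k : ℕ) (hk : 0 < k)
    (P P' : Set U) (hP : IsProfile inv {s : U | ord s < k} P)
    (hP' : IsProfile inv {s : U | ord s < k} P')
    (s : U) (hs : s ∈ P) (hdist : Distinguishes inv s P P')
    (heff : ∀ t ∈ {s : U | ord s < k}, ord t < ord s → ¬ Distinguishes inv t P P') :
    CloselyRelated inv {s : U | ord s < k} P s ∧
      CloselyRelated inv {s : U | ord s < k} P' (inv s) := by
  have hs' : inv s ∈ P' := by
    rcases hdist with ⟨hne, ⟨-, h⟩ | ⟨h, -⟩⟩
    · exact h
    · exact absurd (hP.1.2.2 s hs h) hne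
  refine ⟨closelyRelated_of_efficient hinv hordinv hordsub hP hP'.1 hP'.2.1 hs hs' heff,
    closelyRelated_of_efficient hinv hordinv hordsub hP' hP.1 hP.2.1 hs'
      ((hinv.1 s).symm ▸ hs) fun t ht hlt ⟨hne, hd⟩ => ?_⟩
  exact heff t ht (hordinv s ▸ hlt) ⟨hne, hd.symm.imp And.symm And.symm⟩
end

section
/- Let S⃗ be a finite submodular separation system inside a universe of separations, let s ∈ S⃗, and let M ⊆ S⃗ be a set of oriented separations such that every m ∈ M is closely related to some profile Q_m of S with s ∈ Q_m. Then s ∧ inf(M) lies in S⃗, where inf(M) denotes the meet of all elements of M taken in the universe. Moreover, if s is closely related to some profile P of S, then s ∧ inf(M) is closely related to P. -/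
open SepSys

namespace SepSys

/-- A consistent orientation containing `s` and some `m` above the inverse of `s` has `m = s`. -/
lemma eq_of_inv_le {U : Type*} [Lattice U] {inv : U → U} {Sv Q : Set U} (hinv : IsInvol inv)
    (hO : IsOrientation inv Sv Q) (hC : Consistent inv Q) {s m : U} (hs : s ∈ Q) (hm : m ∈ Q)
    (h : inv s ≤ m) : m = s := by
  by_contra hne
  have hle : inv m ≤ s := by simpa [hinv.1] using hinv.2 _ _ h
  have hms : inv m = s := by
    by_contra hlt
    exact hC m hm s hs hne (lt_of_le_of_ne hle hlt)
  exact hne ((hO.2.2 m hm (hms ▸ hs)).symm.trans hms)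

/-- A consistent orientation is closed downwards, except possibly for inverses. -/
lemma mem_of_le {U : Type*} [Lattice U] {inv : U → U} {Sv Q : Set U} (hinv : IsInvol inv)
    (hO : IsOrientation inv Sv Q) (hC : Consistent inv Q) {s x : U} (hs : s ∈ Q) (hx : x ∈ Sv)
    (h : x ≤ s) (hinvx : x = inv s → x = s) : x ∈ Q := by
  by_cases hxs : x = s
  · exact hxs ▸ hs
  refine (hO.2.1 x hx).resolve_right fun hix => ?_
  refine hC (inv x) hix s hs (fun he => hxs (hinvx ?_)) ?_
  · rw [← he, hinv.1]
  · rw [hinv.1]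
    exact lt_of_le_of_ne h hxs

/-- The meet of `s` with separations closely related to profiles containing `s` can equal the
inverse of `s` only if it equals `s`. -/
lemma isGLB_eq_of_eq_inv {U : Type*} [Lattice U] {inv : U → U} {Sv : Set U} (hinv : IsInvol inv)
    {s t : U} {M : Set U}
    (hMrel : ∀ m ∈ M, ∃ Q : Set U, IsProfile inv Sv Q ∧ s ∈ Q ∧ CloselyRelated inv Sv Q m)
    (ht : IsGLB (insert s M) t) (h : t = inv s) : t = s := by
  refine le_antisymm (ht.1 (Set.mem_insert _ _)) (ht.2 ?_)
  rintro m (rfl | hm)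
  · exact le_rfl
  obtain ⟨Q, hQ, hsQ, hmQ⟩ := hMrel m hm
  exact (eq_of_inv_le hinv hQ.1 hQ.2.1 hsQ hmQ.1
    (h ▸ ht.1 (Set.mem_insert_of_mem _ hm))).ge

lemma exists_isGLB_mem {U : Type*} [Lattice U] {inv : U → U} {Sv : Set U} (hinv : IsInvol inv)
    {s : U} (hsS : s ∈ Sv) {M : Set U} (hfin : M.Finite)
    (hMrel : ∀ m ∈ M, ∃ Q : Set U, IsProfile inv Sv Q ∧ s ∈ Q ∧ CloselyRelated inv Sv Q m) :
    ∃ t ∈ Sv, IsGLB (insert s M) t := by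
  induction M, hfin using Set.Finite.induction_on with
  | empty => exact ⟨s, hsS, by simp⟩
  | @insert m N _ _ ih =>
    have hN := fun n hn => hMrel n (Set.mem_insert_of_mem m hn)
    obtain ⟨t, htS, ht⟩ := ih hN
    obtain ⟨Q, hQ, hsQ, hmQ⟩ := hMrel m (Set.mem_insert _ _)
    refine ⟨m ⊓ t, hmQ.2 t (mem_of_le hinv hQ.1 hQ.2.1 hsQ htS
      (ht.1 (Set.mem_insert _ _)) (isGLB_eq_of_eq_inv hinv hN ht)), ?_⟩
    rw [Set.insert_comm]
    exact ht.insert m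

end SepSys

theorem meet_with_inf_closely_related {U : Type*} [Lattice U] (inv : U → U) (Sv : Set U)
    (hinv : IsInvol inv) (hfin : Sv.Finite) (hsys : IsSepSys inv Sv)
    (hsub : SubmodularSys Sv)
    (s : U) (hsS : s ∈ Sv) (M : Set U) (hM : M ⊆ Sv)
    (hMrel : ∀ m ∈ M, ∃ Q : Set U, IsProfile inv Sv Q ∧ s ∈ Q ∧ CloselyRelated inv Sv Q m) :
    (∃ t : U, IsGLB (insert s M) t) ∧
      ∀ t : U, IsGLB (insert s M) t → t ∈ Sv ∧
        ∀ P : Set U, IsProfile inv Sv P → CloselyRelated inv Sv P s →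
          CloselyRelated inv Sv P t := by
  have hMfin : M.Finite := hfin.subset hM
  obtain ⟨t₀, ht₀S, ht₀⟩ := exists_isGLB_mem hinv hsS hMfin hMrel
  refine ⟨⟨t₀, ht₀⟩, fun t ht => ?_⟩
  obtain rfl := ht.unique ht₀
  refine ⟨ht₀S, fun P hP hsP => ⟨?_, fun r hr => ?_⟩⟩
  · exact mem_of_le hinv hP.1 hP.2.1 hsP.1 ht₀S (ht.1 (Set.mem_insert _ _))
      (isGLB_eq_of_eq_inv hinv hMrel ht)
  have hsr : s ⊓ r = inv s → s ⊓ r = s := fun h => by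
    have hrs : r = s := eq_of_inv_le hinv hP.1 hP.2.1 hsP.1 hr (h ▸ inf_le_right)
    rw [hrs, inf_idem]
  obtain ⟨u, huS, hu⟩ := exists_isGLB_mem hinv (hsP.2 r hr) hMfin fun m hm => by
    obtain ⟨Q, hQ, hsQ, hmQ⟩ := hMrel m hm
    exact ⟨Q, hQ, mem_of_le hinv hQ.1 hQ.2.1 hsQ (hsP.2 r hr) inf_le_left hsr, hmQ⟩
  have htr : IsGLB (insert (s ⊓ r) M) (t ⊓ r) := by
    refine ⟨?_, fun v hv => le_inf (ht.2 ?_) ?_⟩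
    · rintro m (rfl | hm)
      · exact inf_le_inf_right r (ht.1 (Set.mem_insert _ _))
      · exact inf_le_left.trans (ht.1 (Set.mem_insert_of_mem _ hm))
    · rintro m (rfl | hm)
      · exact (hv (Set.mem_insert _ _)).trans inf_le_left
      · exact hv (Set.mem_insert_of_mem _ hm)
    · exact (hv (Set.mem_insert _ _)).trans inf_le_right
  exact htr.unique hu ▸ huS
end

section
/- Let S⃗ be a finite submodular separation system inside a universe of separations and let 𝒫 be a set of profiles of S. If P ∈ 𝒫 is a profile for which the oriented separation s_P was chosen in the construction of N(S⃗, 𝒫), then P lives at the unique node of N(S⃗, 𝒫) that contains s_P. -/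
open SepSys

namespace SepSys

section Involution

variable {U : Type*} [Lattice U] {inv : U → U}

lemma IsInvol.inv_le_inv_iff (h : IsInvol inv) {r s : U} : inv r ≤ inv s ↔ s ≤ r :=
  ⟨fun hrs => by simpa only [h.1] using h.2 _ _ hrs, fun hsr => h.2 _ _ hsr⟩

lemma IsInvol.inv_le_iff (h : IsInvol inv) {r s : U} : inv r ≤ s ↔ inv s ≤ r := by
  rw [← h.inv_le_inv_iff, h.1]

lemma IsInvol.le_inv_iff (h : IsInvol inv) {r s : U} : r ≤ inv s ↔ s ≤ inv r := by
  rw [← h.inv_le_inv_iff, h.1]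

lemma IsInvol.inv_sup (h : IsInvol inv) (r s : U) : inv (r ⊔ s) = inv r ⊓ inv s := by
  apply le_antisymm
  · exact le_inf (h.2 _ _ le_sup_left) (h.2 _ _ le_sup_right)
  · rw [h.le_inv_iff]
    exact sup_le (h.le_inv_iff.1 inf_le_left) (h.le_inv_iff.1 inf_le_right)

lemma IsInvol.inv_inf_s10 (h : IsInvol inv) (r s : U) : inv (r ⊓ s) = inv r ⊔ inv s := by
  rw [← h.1 (inv r ⊔ inv s), h.inv_sup, h.1, h.1]

end Involution

section Profile

variable {U : Type*} [Lattice U] {inv : U → U} {Sv P : Set U}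

lemma IsProfile.inv_mem (hP : IsProfile inv Sv P) {s : U} (hs : s ∈ Sv) (hsP : s ∉ P) :
    inv s ∈ P :=
  (hP.1.2.1 s hs).resolve_left hsP

lemma IsProfile.sup_mem (hP : IsProfile inv Sv P) {r s : U} (hr : r ∈ P) (hs : s ∈ P)
    (hrs : r ⊔ s ∈ Sv) : r ⊔ s ∈ P :=
  (hP.1.2.1 _ hrs).resolve_right (hP.2.2 r hr s hs)

/-- A profile is closed downwards, except possibly at the inverse of the upper bound. -/
lemma IsProfile.mem_or_eq_inv_of_le (hP : IsProfile inv Sv P) (hinv : IsInvol inv) {a b : U}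
    (ha : a ∈ Sv) (hb : b ∈ P) (hab : a ≤ b) : a ∈ P ∨ a = inv b := by
  by_contra! hc
  have hne : inv a ≠ b := fun h => hc.2 (by rw [← h, hinv.1])
  have hlt := hP.2.1 _ (hP.inv_mem ha hc.1) b hb hne
  rw [hinv.1] at hlt
  exact hc.1 (eq_of_le_of_not_lt hab hlt ▸ hb)

lemma IsProfile.eq_of_inv_le (hP : IsProfile inv Sv P) {a b : U}
    (ha : a ∈ P) (hb : b ∈ P) (hab : inv a ≤ b) : a = b := by
  by_contra hne
  have h := eq_of_le_of_not_lt hab (hP.2.1 a ha b hb hne)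
  exact hne ((hP.1.2.2 a ha (h ▸ hb)).symm.trans h)

end Profile

section Step

variable {U : Type*} [Lattice U] {inv : U → U} {Sv N P P' : Set U} {Q : Set (Set U)}

lemma mem_SvM_of_mem (hN : UnorientedIn inv Sv N) (hnest : NestedSet inv N) {t : U}
    (ht : t ∈ N) : t ∈ SvM inv Sv N :=
  ⟨hN.1 ht, fun m hm => hnest t ht m hm⟩

lemma Nested.inv_right (hinv : IsInvol inv) {r s : U} (h : Nested inv r (inv s)) :
    Nested inv r s := by
  unfold Nested at h ⊢
  rw [hinv.1] at h
  tauto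

lemma Nested.inv_left (hinv : IsInvol inv) {r s : U} (h : Nested inv r s) :
    Nested inv (inv r) s := by
  unfold Nested at h ⊢
  rw [hinv.1]
  tauto

lemma Nested.symm (hinv : IsInvol inv) {r s : U} (h : Nested inv r s) : Nested inv s r := by
  rcases h with h | h | h | h
  · exact Or.inr (Or.inr (Or.inr (hinv.2 _ _ h)))
  · exact Or.inr (Or.inl (hinv.le_inv_iff.1 h))
  · exact Or.inr (Or.inr (Or.inl (hinv.inv_le_iff.1 h)))
  · exact Or.inl (hinv.inv_le_inv_iff.1 h)

lemma Nested.of_le_or_le_inv (hinv : IsInvol inv) {x t : U} (h : t ≤ x ∨ x ≤ inv t) :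
    Nested inv x t :=
  h.elim (fun h => Or.inr (Or.inr (Or.inr (hinv.2 _ _ h)))) (fun h => Or.inr (Or.inl h))

lemma mem_SvM_of_forall_mem (hinv : IsInvol inv) (hN : UnorientedIn inv Sv N)
    (hP : IsProfile inv Sv P) {x : U} (hx : x ∈ Sv)
    (h : ∀ t ∈ N, t ∈ P → Nested inv x t) : x ∈ SvM inv Sv N := by
  refine ⟨hx, fun m hm => ?_⟩
  by_cases hmP : m ∈ P
  · exact h m hm hmP
  · exact (h (inv m) (hN.2 m hm) (hP.inv_mem (hN.1 hm) hmP)).inv_right hinv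

lemma le_or_le_inv_of_mem_MpOf (hinv : IsInvol inv) (hN : UnorientedIn inv Sv N)
    (hnest : NestedSet inv N) (hP : IsProfile inv Sv P) {r : U} (hr : r ∈ MpOf inv Sv N Q P)
    {t : U} (ht : t ∈ N) (htP : t ∈ P) : t ≤ r ∨ r ≤ inv t := by
  obtain ⟨hrS, hrP, -, hmax⟩ := hr
  rcases hrS.2 t ht with h | h | h | h
  · exact Or.inl (hmax t ⟨htP, mem_SvM_of_mem hN hnest ht⟩ h).ge
  · exact Or.inr h
  · exact Or.inl (hP.eq_of_inv_le hrP htP h).ge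
  · exact Or.inl (hinv.inv_le_inv_iff.1 h)

lemma inv_ne_of_exclusive (hPs : ∀ P ∈ Q, IsProfile inv Sv P) (hQ : ¬ Q.Subsingleton) {s : U}
    (hs : s ∈ Sv) (hex : ∀ P' ∈ Q, s ∈ P' → P' = P) : inv s ≠ s := by
  intro hdeg
  have hmem : ∀ P' ∈ Q, s ∈ P' := fun P' hP' => by
    rcases (hPs P' hP').1.2.1 s hs with h | h
    · exact h
    · rwa [hdeg] at h
  exact hQ fun A hA B hB => (hex A hA (hmem A hA)).trans (hex B hB (hmem B hB)).symm

/-- The infimum of `MpOf` is again a separation of the current system in `P`, it is exclusive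
for `P`, and it is oriented compatibly with the elements of `N` in `P`. -/
lemma isGLB_MpOf_spec (hinv : IsInvol inv) (hfin : Sv.Finite) (hsub : SubmodularSys Sv)
    (hN : UnorientedIn inv Sv N) (hnest : NestedSet inv N)
    (hPs : ∀ P ∈ Q, IsProfile inv Sv P) (hP : P ∈ QiOf inv Sv N Q)
    {s : U} (hs : IsGLB (MpOf inv Sv N Q P) s) :
    s ∈ SvM inv Sv N ∧ s ∈ P ∧ (∀ P' ∈ Q, s ∈ P' → P' = P) ∧
      ∀ t ∈ N, t ∈ P → t ≤ s ∨ s ≤ inv t := by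
  have hprof := hPs P hP.1
  have hMfin : (MpOf inv Sv N Q P).Finite := hfin.subset fun x hx => hx.1.1
  have key : ∀ F : Set U, F.Finite → F ⊆ MpOf inv Sv N Q P → F.Nonempty →
      ∃ x, IsGLB F x ∧ x ∈ Sv ∧ x ∈ P ∧ (∀ P' ∈ Q, x ∈ P' → P' = P) ∧
        ∀ t ∈ N, t ∈ P → t ≤ x ∨ x ≤ inv t := by
    intro F hF
    induction F, hF using Set.Finite.induction_on with
    | empty => exact fun _ h => absurd h Set.not_nonempty_empty
    | @insert r F _ _ ih =>
      intro hsubset _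
      have hr : r ∈ MpOf inv Sv N Q P := hsubset (Set.mem_insert _ _)
      have hrN := fun t ht htP => le_or_le_inv_of_mem_MpOf hinv hN hnest hprof hr (t := t) ht htP
      rcases F.eq_empty_or_nonempty with rfl | hne
      · exact ⟨r, by simp, hr.1.1, hr.2.1, hr.2.2.1, hrN⟩
      obtain ⟨x, hxF, hxS, hxP, hxex, hxN⟩ :=
        ih (fun y hy => hsubset (Set.mem_insert_of_mem _ hy)) hne
      refine ⟨r ⊓ x, hxF.insert r, ?_⟩
      by_cases hxr : x ≤ r
      · rw [inf_eq_right.2 hxr]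
        exact ⟨hxS, hxP, hxex, hxN⟩
      have hsup : r ⊔ x ∉ Sv := by
        intro h
        have hmem : r ⊔ x ∈ SvM inv Sv N := by
          refine mem_SvM_of_forall_mem hinv hN hprof h fun t ht htP => .of_le_or_le_inv hinv ?_
          rcases hrN t ht htP with h1 | h1
          · exact Or.inl (h1.trans le_sup_left)
          rcases hxN t ht htP with h2 | h2
          · exact Or.inl (h2.trans le_sup_right)
          · exact Or.inr (sup_le h1 h2)
        have heq := hr.2.2.2 _ ⟨hprof.sup_mem hr.2.1 hxP h, hmem⟩ le_sup_left
        exact hxr (sup_eq_left.1 heq.symm)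
      have hinf : r ⊓ x ∈ Sv := (hsub r hr.1.1 x hxS).resolve_left hsup
      refine ⟨hinf, ?_, ?_, ?_⟩
      · rcases hprof.mem_or_eq_inv_of_le hinv hinf hr.2.1 inf_le_left with h | h
        · exact h
        · exact absurd (hprof.eq_of_inv_le hr.2.1 hxP (h ▸ inf_le_right)).ge hxr
      · intro P' hP' hmem
        by_contra hPP
        have h1 := (hPs P' hP').inv_mem hr.1.1 fun h => hPP (hr.2.2.1 P' hP' h)
        have h2 := (hPs P' hP').inv_mem hxS fun h => hPP (hxex P' hP' h)
        refine (hPs P' hP').2.2 _ h1 _ h2 ?_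
        rwa [hinv.inv_sup, hinv.1, hinv.1]
      · intro t ht htP
        rcases hrN t ht htP with h1 | h1
        · rcases hxN t ht htP with h2 | h2
          · exact Or.inl (le_inf h1 h2)
          · exact Or.inr (inf_le_right.trans h2)
        · exact Or.inr (inf_le_left.trans h1)
  obtain ⟨x, hx, hxS, hxP, hxex, hxN⟩ := key _ hMfin subset_rfl hP.2
  obtain rfl := hx.unique hs
  exact ⟨mem_SvM_of_forall_mem hinv hN hprof hxS
    fun t ht htP => .of_le_or_le_inv hinv (hxN t ht htP), hxP, hxex, hxN⟩

lemma sup_inv_mem_SvM (hinv : IsInvol inv) (hN : UnorientedIn inv Sv N)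
    (hnest : NestedSet inv N) (hPs : ∀ P ∈ Q, IsProfile inv Sv P)
    (hP : P ∈ Q) (hP' : P' ∈ Q) (hne : P ≠ P') {r s : U} (hr : r ∈ MpOf inv Sv N Q P)
    (hs : s ∈ MpOf inv Sv N Q P') (h : r ⊔ inv s ∈ Sv) : r ⊔ inv s ∈ SvM inv Sv N := by
  refine mem_SvM_of_forall_mem hinv hN (hPs P hP) h fun t ht htP => ?_
  rcases le_or_le_inv_of_mem_MpOf hinv hN hnest (hPs P hP) hr ht htP with h1 | h1
  · exact .of_le_or_le_inv hinv (Or.inl (h1.trans le_sup_left))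
  by_cases htP' : t ∈ P'
  · rcases le_or_le_inv_of_mem_MpOf hinv hN hnest (hPs P' hP') hs ht htP' with h2 | h2
    · exact .of_le_or_le_inv hinv (Or.inr (sup_le h1 (hinv.2 _ _ h2)))
    · exact .of_le_or_le_inv hinv (Or.inl ((hinv.le_inv_iff.1 h2).trans le_sup_right))
  · rcases le_or_le_inv_of_mem_MpOf hinv hN hnest (hPs P' hP') hs (hN.2 t ht)
      ((hPs P' hP').inv_mem (hN.1 ht) htP') with h2 | h2
    · rcases (hPs P' hP').mem_or_eq_inv_of_le hinv hr.1.1 hs.2.1 (h1.trans h2) with h3 | h3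
      · exact absurd (hr.2.2.1 P' hP' h3).symm hne
      · exact .of_le_or_le_inv hinv (Or.inr (by rwa [← h3, sup_idem]))
    · exact Or.inr (Or.inr (Or.inl
        (hinv.inv_le_iff.1 ((hinv.le_inv_iff.1 h2).trans le_sup_right))))

lemma inv_le_of_mem_MpOf (hinv : IsInvol inv) (hsys : IsSepSys inv Sv) (hsub : SubmodularSys Sv)
    (hN : UnorientedIn inv Sv N) (hnest : NestedSet inv N)
    (hPs : ∀ P ∈ Q, IsProfile inv Sv P) (hP : P ∈ Q) (hP' : P' ∈ Q) (hne : P ≠ P') {r s : U}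
    (hr : r ∈ MpOf inv Sv N Q P) (hs : s ∈ MpOf inv Sv N Q P') : inv r ≤ s := by
  have hsP : inv s ∈ P := (hPs P hP).inv_mem hs.1.1 fun h => hne (hs.2.2.1 P hP h)
  have hrP' : inv r ∈ P' := (hPs P' hP').inv_mem hr.1.1 fun h => hne (hr.2.2.1 P' hP' h).symm
  rcases hsub r hr.1.1 (inv s) (hsys s hs.1.1) with h | h
  · have heq := hr.2.2.2 _ ⟨(hPs P hP).sup_mem hr.2.1 hsP h,
      sup_inv_mem_SvM hinv hN hnest hPs hP hP' hne hr hs h⟩ le_sup_left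
    exact hinv.inv_le_iff.1 (sup_eq_left.1 heq.symm)
  · have h' : s ⊔ inv r ∈ Sv := by
      have := hsys _ h
      rwa [hinv.inv_inf_s10, hinv.1, sup_comm] at this
    have heq := hs.2.2.2 _ ⟨(hPs P' hP').sup_mem hs.2.1 hrP' h',
      sup_inv_mem_SvM hinv hN hnest hPs hP' hP hne.symm hs hr h'⟩ le_sup_left
    exact sup_eq_left.1 heq.symm

lemma inv_le_of_isGLB_MpOf (hinv : IsInvol inv) (hsys : IsSepSys inv Sv)
    (hsub : SubmodularSys Sv) (hN : UnorientedIn inv Sv N) (hnest : NestedSet inv N)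
    (hPs : ∀ P ∈ Q, IsProfile inv Sv P) (hP : P ∈ Q) (hP' : P' ∈ Q) (hne : P ≠ P') {r s : U}
    (hr : IsGLB (MpOf inv Sv N Q P) r) (hs : IsGLB (MpOf inv Sv N Q P') s) : inv r ≤ s :=
  hs.2 fun _ hy => hinv.inv_le_iff.1 <| hr.2 fun _ hx => hinv.inv_le_iff.1 <|
    inv_le_of_mem_MpOf hinv hsys hsub hN hnest hPs hP hP' hne hx hy

/-- The separations added to `N` in one step of the construction, in both orientations. -/
def newSeps (inv : U → U) (Sv N : Set U) (Q : Set (Set U)) : Set U :=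
  {x | ∃ P ∈ QiOf inv Sv N Q, ∃ y, IsGLB (MpOf inv Sv N Q P) y ∧ (x = y ∨ x = inv y)}

lemma newSeps_spec (hinv : IsInvol inv) (hfin : Sv.Finite) (hsys : IsSepSys inv Sv)
    (hsub : SubmodularSys Sv) (hN : UnorientedIn inv Sv N) (hnest : NestedSet inv N)
    (hdeg : ∀ t ∈ N, inv t ≠ t)
    (hPs : ∀ P ∈ Q, IsProfile inv Sv P) (hQ : ¬ Q.Subsingleton) :
    UnorientedIn inv Sv (N ∪ newSeps inv Sv N Q) ∧ NestedSet inv (N ∪ newSeps inv Sv N Q) ∧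
      ∀ t ∈ N ∪ newSeps inv Sv N Q, inv t ≠ t := by
  have spec := fun {P y} (hP : P ∈ QiOf inv Sv N Q) (hy : IsGLB (MpOf inv Sv N Q P) y) =>
    isGLB_MpOf_spec hinv hfin hsub hN hnest hPs hP hy
  have hNnew : ∀ r ∈ newSeps inv Sv N Q, ∀ t ∈ N, Nested inv r t := by
    rintro r ⟨P, hP, y, hy, rfl | rfl⟩ t ht
    · exact (spec hP hy).1.2 t ht
    · exact ((spec hP hy).1.2 t ht).inv_left hinv
  have hGLB : ∀ P ∈ QiOf inv Sv N Q, ∀ y, IsGLB (MpOf inv Sv N Q P) y →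
      ∀ P' ∈ QiOf inv Sv N Q, ∀ z, IsGLB (MpOf inv Sv N Q P') z → Nested inv y z := by
    intro P hP y hy P' hP' z hz
    by_cases h : P = P'
    · subst h
      exact Or.inl (hy.unique hz).le
    · exact Or.inr (Or.inr (Or.inl
        (inv_le_of_isGLB_MpOf hinv hsys hsub hN hnest hPs hP.1 hP'.1 h hy hz)))
  refine ⟨⟨?_, ?_⟩, ?_, ?_⟩
  · rintro x (hx | ⟨P, hP, y, hy, rfl | rfl⟩)
    · exact hN.1 hx
    · exact (spec hP hy).1.1
    · exact hsys _ (spec hP hy).1.1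
  · rintro x (hx | ⟨P, hP, y, hy, rfl | rfl⟩)
    · exact Or.inl (hN.2 x hx)
    · exact Or.inr ⟨P, hP, x, hy, Or.inr rfl⟩
    · exact Or.inr ⟨P, hP, y, hy, Or.inl (hinv.1 y)⟩
  · rintro r (hr | hr) t (ht | ht)
    · exact hnest r hr t ht
    · exact (hNnew t ht r hr).symm hinv
    · exact hNnew r hr t ht
    · obtain ⟨P, hP, y, hy, hry⟩ := hr
      obtain ⟨P', hP', z, hz, htz⟩ := ht
      have h := hGLB P hP y hy P' hP' z hz
      rcases hry with rfl | rfl <;> rcases htz with rfl | rfl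
      · exact h
      · exact Nested.inv_right hinv (by rwa [hinv.1])
      · exact h.inv_left hinv
      · exact Nested.inv_right hinv (by rw [hinv.1]; exact h.inv_left hinv)
  · rintro x (hx | ⟨P, hP, y, hy, rfl | rfl⟩)
    · exact hdeg x hx
    · exact inv_ne_of_exclusive hPs hQ (spec hP hy).1.1 (spec hP hy).2.2.1
    · rw [hinv.1]
      exact (inv_ne_of_exclusive hPs hQ (spec hP hy).1.1 (spec hP hy).2.2.1).symm

lemma exists_mem_of_mem_newSeps (hinv : IsInvol inv) (hfin : Sv.Finite)
    (hsub : SubmodularSys Sv) (hN : UnorientedIn inv Sv N) (hnest : NestedSet inv N)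
    (hPs : ∀ P ∈ Q, IsProfile inv Sv P) (hQ : ¬ Q.Subsingleton) {t : U}
    (ht : t ∈ newSeps inv Sv N Q) : ∃ P' ∈ Q, t ∈ P' := by
  obtain ⟨P, hP, y, hy, rfl | rfl⟩ := ht
  · exact ⟨P, hP.1, (isGLB_MpOf_spec hinv hfin hsub hN hnest hPs hP hy).2.1⟩
  · obtain ⟨hyS, -, hex, -⟩ := isGLB_MpOf_spec hinv hfin hsub hN hnest hPs hP hy
    obtain ⟨P', hP', hne⟩ := (Set.not_subsingleton_iff.1 hQ).exists_ne P
    exact ⟨P', hP', (hPs P' hP').inv_mem hyS.1 fun h => hne (hex P' hP' h)⟩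

end Step

section Construction

variable {U : Type*} [Lattice U] {inv : U → U} {Sv : Set U} {Ps : Set (Set U)}

lemma constrStep_succ (i : ℕ) : constrStep inv Sv Ps (i + 1) =
    ((constrStep inv Sv Ps i).1 ∪
        newSeps inv Sv (constrStep inv Sv Ps i).1 (constrStep inv Sv Ps i).2,
      (constrStep inv Sv Ps i).2 \
        QiOf inv Sv (constrStep inv Sv Ps i).1 (constrStep inv Sv Ps i).2) :=
  rfl

lemma not_subsingleton_constrStep {i : ℕ} (hi : i < stopIndex inv Sv Ps) :
    ¬ (constrStep inv Sv Ps i).2.Subsingleton :=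
  Nat.notMem_of_lt_sInf hi

lemma antitone_constrStep_snd : Antitone fun i => (constrStep inv Sv Ps i).2 :=
  antitone_nat_of_succ_le fun _ => Set.sdiff_subset

lemma monotone_constrStep_fst : Monotone fun i => (constrStep inv Sv Ps i).1 :=
  monotone_nat_of_le_succ fun _ => Set.subset_union_left

lemma constrStep_fst_spec (hinv : IsInvol inv) (hfin : Sv.Finite) (hsys : IsSepSys inv Sv)
    (hsub : SubmodularSys Sv) (hPs : ∀ P ∈ Ps, IsProfile inv Sv P) {i : ℕ}
    (hi : i ≤ stopIndex inv Sv Ps) :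
    UnorientedIn inv Sv (constrStep inv Sv Ps i).1 ∧ NestedSet inv (constrStep inv Sv Ps i).1 ∧
      ∀ t ∈ (constrStep inv Sv Ps i).1, inv t ≠ t := by
  induction i with
  | zero => exact ⟨⟨Set.empty_subset _, fun _ h => h.elim⟩, fun _ h => h.elim, fun _ h => h.elim⟩
  | succ i ih =>
    obtain ⟨hN, hnest, hdeg⟩ := ih (Nat.le_of_succ_le hi)
    exact newSeps_spec hinv hfin hsys hsub hN hnest hdeg
      (fun P hP => hPs P (antitone_constrStep_snd (Nat.zero_le i) hP))
      (not_subsingleton_constrStep hi)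

lemma mem_constrStep_fst_or_exists_mem (hinv : IsInvol inv) (hfin : Sv.Finite)
    (hsys : IsSepSys inv Sv) (hsub : SubmodularSys Sv) (hPs : ∀ P ∈ Ps, IsProfile inv Sv P)
    {i j : ℕ} (hij : i ≤ j) (hj : j ≤ stopIndex inv Sv Ps) {t : U}
    (ht : t ∈ (constrStep inv Sv Ps j).1) :
    t ∈ (constrStep inv Sv Ps i).1 ∨ ∃ P' ∈ (constrStep inv Sv Ps i).2, t ∈ P' := by
  induction j, hij using Nat.le_induction with
  | base => exact Or.inl ht
  | succ j hij ih =>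
    rcases ht with ht | ht
    · exact ih (Nat.le_of_succ_le hj) ht
    · obtain ⟨hN, hnest, -⟩ :=
        constrStep_fst_spec hinv hfin hsys hsub hPs (Nat.le_of_succ_le hj)
      obtain ⟨P', hP', htP'⟩ := exists_mem_of_mem_newSeps hinv hfin hsub hN hnest
        (fun P hP => hPs P (antitone_constrStep_snd (Nat.zero_le j) hP))
        (not_subsingleton_constrStep hj) ht
      exact Or.inr ⟨P', antitone_constrStep_snd hij hP', htP'⟩

end Construction

section Node

variable {U : Type*} [Lattice U] {inv : U → U} {Sv N P : Set U}

lemma IsProfile.isOrientation_inter (hP : IsProfile inv Sv P) (hN : UnorientedIn inv Sv N) :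
    IsOrientation inv N (P ∩ N) :=
  ⟨Set.inter_subset_right,
    fun s hs => (hP.1.2.1 s (hN.1 hs)).imp (fun h => ⟨h, hs⟩) fun h => ⟨h, hN.2 s hs⟩,
    fun s hs h => hP.1.2.2 s hs.1 h.1⟩

lemma isNode_maxElems (hnest : NestedSet inv N) (hinv : IsInvol inv)
    (hdeg : ∀ t ∈ N, inv t ≠ t) {O : Set U} (hO : IsOrientation inv N O)
    (hcons : Consistent inv O) : IsNode inv N (MaxElems O) := by
  refine ⟨⟨fun x hx => hO.1 hx.1, fun x hx => hdeg x (hO.1 hx.1), fun r hr s hs hne => ?_⟩,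
    O, hO, hcons, rfl⟩
  rcases hnest r (hO.1 hr.1) s (hO.1 hs.1) with h | h | h | h
  · exact absurd (hr.2 s hs.1 h) hne
  · exact h
  · have heq := eq_of_le_of_not_lt h (hcons r hr.1 s hs.1 hne)
    exact absurd (hO.2.2 r hr.1 (heq ▸ hs.1)) (hdeg r (hO.1 hr.1))
  · exact absurd (hs.2 r hr.1 (hinv.inv_le_inv_iff.1 h)).symm hne

lemma subset_of_mem_maxElems (hinv : IsInvol inv) (hnest : NestedSet inv N)
    (hdeg : ∀ t ∈ N, inv t ≠ t) {O O' : Set U}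
    (hO : IsOrientation inv N O) (hcons : Consistent inv O)
    (hO' : IsOrientation inv N O') (hcons' : Consistent inv O') {s : U}
    (hs : s ∈ MaxElems O) (hs' : s ∈ MaxElems O') : O ⊆ O' := by
  intro t ht
  by_contra htO'
  have hti : inv t ∈ O' := (hO'.2.1 t (hO.1 ht)).resolve_left htO'
  have hts : t ≠ s := fun h => htO' (h ▸ hs'.1)
  have htis : inv t ≠ s := fun h =>
    hdeg t (hO.1 ht) (hO.2.2 t ht (h ▸ hs.1))
  rcases hnest t (hO.1 ht) s (hO.1 hs.1) with h | h | h | h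
  · refine hcons' _ hti s hs'.1 htis ?_
    rw [hinv.1]
    exact lt_of_le_of_ne h hts
  · exact htis (hs'.2 _ hti (hinv.le_inv_iff.1 h)).symm
  · exact hcons t ht s hs.1 hts (lt_of_le_of_ne h htis)
  · exact hts (hs.2 t ht (hinv.inv_le_inv_iff.1 h)).symm

/-- A nested set has at most one node containing a given oriented separation. -/
lemma IsNode.eq_of_mem (hinv : IsInvol inv) (hnest : NestedSet inv N)
    (hdeg : ∀ t ∈ N, inv t ≠ t) {σ τ : Set U} (hσ : IsNode inv N σ) (hτ : IsNode inv N τ)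
    {s : U} (hsσ : s ∈ σ) (hsτ : s ∈ τ) : σ = τ := by
  obtain ⟨-, O, hO, hcons, rfl⟩ := hσ
  obtain ⟨-, O', hO', hcons', rfl⟩ := hτ
  have : O = O' := (subset_of_mem_maxElems hinv hnest hdeg hO hcons hO' hcons' hsσ hsτ).antisymm
    (subset_of_mem_maxElems hinv hnest hdeg hO' hcons' hO hcons hsτ hsσ)
  rw [this]

end Node

end SepSys

theorem profile_lives_at_node_containing_sP {U : Type*} [Lattice U] (inv : U → U) (Sv : Set U)
    (hinv : IsInvol inv) (hfin : Sv.Finite) (hsys : IsSepSys inv Sv)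
    (hsub : SubmodularSys Sv)
    (Ps : Set (Set U)) (hPs : ∀ P ∈ Ps, IsProfile inv Sv P)
    (i : ℕ) (hi : i < stopIndex inv Sv Ps)
    (P : Set U) (hP : P ∈ QiOf inv Sv (constrStep inv Sv Ps i).1 (constrStep inv Sv Ps i).2)
    (s : U)
    (hs : IsGLB (MpOf inv Sv (constrStep inv Sv Ps i).1 (constrStep inv Sv Ps i).2 P) s) :
    (∃! σ : Set U, IsNode inv (canonicalN inv Sv Ps) σ ∧ s ∈ σ) ∧
      ∀ σ : Set U, IsNode inv (canonicalN inv Sv Ps) σ → s ∈ σ → σ ⊆ P := by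
  obtain ⟨hN, hnest, -⟩ := constrStep_fst_spec hinv hfin hsys hsub hPs hi.le
  obtain ⟨hK, hKnest, hKdeg⟩ :=
    constrStep_fst_spec hinv hfin hsys hsub hPs (le_refl (stopIndex inv Sv Ps))
  have hQ := not_subsingleton_constrStep hi
  have hPsi : ∀ P ∈ (constrStep inv Sv Ps i).2, IsProfile inv Sv P := fun P hP =>
    hPs P (antitone_constrStep_snd (Nat.zero_le i) hP)
  have hprof := hPsi P hP.1
  obtain ⟨hsS, hsP, hex, hcomp⟩ := isGLB_MpOf_spec hinv hfin hsub hN hnest hPsi hP hs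
  have hsdeg := inv_ne_of_exclusive hPsi hQ hsS.1 hex
  have hsK : s ∈ canonicalN inv Sv Ps :=
    monotone_constrStep_fst (Nat.succ_le_of_lt hi) (Or.inr ⟨P, hP, s, hs, Or.inl rfl⟩)
  -- No element of `P` above `s` lies in another profile that is still undistinguished.
  have habove : ∀ t ∈ P, s ≤ t → ∀ P' ∈ (constrStep inv Sv Ps i).2, t ∈ P' → P' = P := by
    intro t htP hst P' hP' htP'
    rcases (hPsi P' hP').mem_or_eq_inv_of_le hinv hsS.1 htP' hst with h | h
    · exact hex P' hP' h
    · refine absurd (hprof.1.2.2 s hsP ?_) hsdeg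
      rwa [h, hinv.1]
  have hmax : s ∈ MaxElems (P ∩ canonicalN inv Sv Ps) := by
    refine ⟨⟨hsP, hsK⟩, fun t ⟨htP, htK⟩ hst => ?_⟩
    rcases mem_constrStep_fst_or_exists_mem hinv hfin hsys hsub hPs (Nat.succ_le_of_lt hi)
      le_rfl htK with (ht | ⟨P', hP', y, hy, hty⟩) | ⟨P', hP', htP'⟩
    · rcases hcomp t ht htP with h | h
      · exact hst.antisymm h
      · obtain ⟨P', hP', hne⟩ := (Set.not_subsingleton_iff.1 hQ).exists_ne P
        have htP' := (hPsi P' hP').inv_mem (hN.1 ht) fun h => hne (habove t htP hst P' hP' h)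
        rcases (hPsi P' hP').mem_or_eq_inv_of_le hinv hsS.1 htP' h with h' | h'
        · exact absurd (hex P' hP' h') hne
        · rwa [hinv.1] at h'
    · by_cases hPP : P' = P
      · subst hPP
        obtain rfl := hs.unique hy
        rcases hty with rfl | rfl
        · rfl
        · exact absurd (hprof.1.2.2 s hsP htP) hsdeg
      · rcases hty with rfl | rfl
        · exact absurd ((isGLB_MpOf_spec hinv hfin hsub hN hnest hPsi hP' hy).2.2.1 P hP.1 htP).symm
            hPP
        · exact hst.antisymm
            (inv_le_of_isGLB_MpOf hinv hsys hsub hN hnest hPsi hP'.1 hP.1 hPP hy hs)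
    · exact absurd hP (habove t htP hst P' hP'.1 htP' ▸ hP'.2)
  have hnode : IsNode inv (canonicalN inv Sv Ps) (MaxElems (P ∩ canonicalN inv Sv Ps)) :=
    isNode_maxElems hKnest hinv hKdeg (hprof.isOrientation_inter hK)
      fun a ha b hb => hprof.2.1 a ha.1 b hb.1
  have huniq : ∀ σ : Set U, IsNode inv (canonicalN inv Sv Ps) σ → s ∈ σ →
      σ = MaxElems (P ∩ canonicalN inv Sv Ps) := fun σ hσ hsσ =>
    hσ.eq_of_mem hinv hKnest hKdeg hnode hsσ hmax
  refine ⟨⟨_, ⟨hnode, hmax⟩, fun σ hσ => huniq σ hσ.1 hσ.2⟩, fun σ hσ hsσ => ?_⟩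
  rw [huniq σ hσ hsσ]
  exact fun x hx => hx.1.1
end
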